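/- Let Ω be a finite set and let G be a solvable subgroup of the symmetric group on Ω. Then there exists a subset Δ of Ω whose setwise stabilizer S in G has a normal elementary abelian 3-subgroup N (possibly trivial) such that the quotient S/N is a 2-group; equivalently, O²(S) is a (possibly trivial) elementary abelian 3-group. -/

import Mathlib

open Pointwise

/-- A finite group `S` has the "required structure" if it has a (possibly trivial) normal
elementary abelian 3-subgroup `N` such that the quotient `S/N` is a 2-group. -/
def RequiredStructure (S : Type*) [Group S] : Prop :=
  ∃ (N : Subgroup S) (hN : N.Normal),
    (∀ x ∈ N, ∀ y ∈ N, x * y = y * x) ∧ (∀ x ∈ N, x ^ 3 = 1) ∧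
    @IsPGroup 2 (S ⧸ N) (@QuotientGroup.Quotient.group S _ N hN)

namespace SetStabilizer

open Equiv
open scoped commutatorElement

/-- An elementwise form of `RequiredStructure`. -/
def IsThreeTwo (S : Type*) [Group S] : Prop :=
  (∀ g : S, ∃ k : ℕ, g ^ (3 * 2 ^ k) = 1) ∧
    ∀ g h : S, g ^ 3 = 1 → h ^ 3 = 1 → g * h = h * g

theorem IsThreeTwo.requiredStructure {S : Type*} [Group S] (h : IsThreeTwo S) :
    RequiredStructure S := by
  let N : Subgroup S :=
    { carrier := {g | g ^ 3 = 1}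
      one_mem' := by simp
      mul_mem' := by
        intro a b ha hb
        have hab : Commute a b := h.2 a b ha hb
        simp only [Set.mem_ofPred_eq] at *
        rw [hab.mul_pow, ha, hb, one_mul]
      inv_mem' := by
        intro a ha
        simp only [Set.mem_ofPred_eq] at *
        rw [inv_pow, ha, inv_one] }
  have hN : N.Normal := ⟨fun n hn g => by
    change (g * n * g⁻¹) ^ 3 = 1
    have : n ^ 3 = 1 := hn
    rw [conj_pow, this]; simp⟩
  refine ⟨N, hN, fun x hx y hy => h.2 x y hx hy, fun x hx => hx, fun q => ?_⟩
  obtain ⟨g, rfl⟩ := QuotientGroup.mk_surjective q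
  obtain ⟨k, hk⟩ := h.1 g
  refine ⟨k, ?_⟩
  rw [← QuotientGroup.mk_pow, QuotientGroup.eq_one_iff]
  change (g ^ 2 ^ k) ^ 3 = 1
  rw [← pow_mul, mul_comm, hk]

/-- If `x` is fixed by an odd power of `g` and by some `g ^ 2 ^ k`, it is fixed by `g`. -/
theorem smul_eq_of_pow_two_pow_of_odd {S X : Type*} [Group S] [MulAction S X] {g : S} {x : X}
    {k m : ℕ} (hm : Odd m) (h1 : g ^ 2 ^ k • x = x) (h2 : g ^ m • x = x) : g • x = x := by
  have hc : Nat.Coprime (2 ^ k) m := Nat.Coprime.pow_left k (Nat.coprime_two_left.2 hm)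
  exact MulAction.period_eq_one_iff.1 (Nat.eq_one_of_dvd_coprimes hc
    (MulAction.pow_smul_eq_iff_period_dvd.1 h1) (MulAction.pow_smul_eq_iff_period_dvd.1 h2))

theorem eq_one_of_pow_two_pow_of_odd {S : Type*} [Group S] {g : S}
    {k m : ℕ} (hm : Odd m) (h1 : g ^ 2 ^ k = 1) (h2 : g ^ m = 1) : g = 1 := by
  have hc : Nat.Coprime (2 ^ k) m := Nat.Coprime.pow_left k (Nat.coprime_two_left.2 hm)
  exact orderOf_eq_one_iff.1 (Nat.eq_one_of_dvd_coprimes hc (orderOf_dvd_of_pow_eq_one h1)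
    (orderOf_dvd_of_pow_eq_one h2))

theorem IsThreeTwo.of_injective {S T : Type*} [Group S] [Group T] (hT : IsThreeTwo T)
    (f : S →* T) (hf : Function.Injective f) : IsThreeTwo S := by
  refine ⟨fun g => ?_, fun g h hg hh => hf ?_⟩
  · obtain ⟨k, hk⟩ := hT.1 (f g)
    exact ⟨k, hf (by simpa using hk)⟩
  · simpa using hT.2 (f g) (f h) (by rw [← map_pow, hg, map_one]) (by rw [← map_pow, hh, map_one])

theorem IsThreeTwo.prod {S T : Type*} [Group S] [Group T] (hS : IsThreeTwo S)
    (hT : IsThreeTwo T) : IsThreeTwo (S × T) := by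
  refine ⟨fun ⟨a, b⟩ => ?_, fun ⟨a, b⟩ ⟨c, d⟩ h1 h2 => ?_⟩
  · obtain ⟨k, hk⟩ := hS.1 a
    obtain ⟨l, hl⟩ := hT.1 b
    refine ⟨k + l, ?_⟩
    ext
    · simp [pow_add, ← mul_assoc, pow_mul _ (3 * 2 ^ k), hk]
    · have : 3 * 2 ^ (k + l) = 3 * 2 ^ l * 2 ^ k := by ring
      simp [this, pow_mul _ (3 * 2 ^ l), hl]
  · simp only [Prod.ext_iff, Prod.pow_fst, Prod.pow_snd, Prod.fst_one, Prod.snd_one] at h1 h2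
    simp only [Prod.mk_mul_mk]
    rw [hS.2 a c h1.1 h2.1, hT.2 b d h1.2 h2.2]

theorem _root_.IsPGroup.isThreeTwo {S : Type*} [Group S] (h : IsPGroup 2 S) : IsThreeTwo S := by
  have key : ∀ g : S, g ^ 3 = 1 → g = 1 := fun g hg => by
    obtain ⟨k, hk⟩ := h g
    exact eq_one_of_pow_two_pow_of_odd (by decide) hk hg
  refine ⟨fun g => ?_, fun g h hg hh => ?_⟩
  · obtain ⟨k, hk⟩ := h g
    exact ⟨k, by rw [mul_comm, pow_mul, hk, one_pow]⟩
  · rw [key g hg, key h hh]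

theorem IsThreeTwo.of_subgroup {S : Type*} [Group S] (S₀ : Subgroup S)
    (h : ∀ g : S, ∃ k : ℕ, g ^ 2 ^ k ∈ S₀) (h₀ : IsThreeTwo S₀) : IsThreeTwo S := by
  have key : ∀ g : S, g ^ 3 = 1 → g ∈ S₀ := fun g hg => by
    obtain ⟨k, hk⟩ := h g
    have hc : (orderOf g).Coprime (2 ^ k) :=
      Nat.Coprime.of_dvd_left (orderOf_dvd_of_pow_eq_one hg) (Nat.Coprime.pow_right k (by decide))
    obtain ⟨m, hm⟩ := exists_pow_eq_self_of_coprime hc.symm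
    rw [← hm]
    exact S₀.pow_mem hk m
  refine ⟨fun g => ?_, fun a b ha hb => ?_⟩
  · obtain ⟨k, hk⟩ := h g
    obtain ⟨l, hl⟩ := h₀.1 ⟨_, hk⟩
    refine ⟨k + l, ?_⟩
    have := congrArg Subtype.val hl
    simp only [SubmonoidClass.mk_pow, OneMemClass.coe_one, ← pow_mul] at this
    rw [← this]; congr 1; ring
  · have := h₀.2 ⟨a, key a ha⟩ ⟨b, key b hb⟩ (Subtype.ext (by simpa using ha))
      (Subtype.ext (by simpa using hb))
    simpa using congrArg Subtype.val this

theorem isPGroup_two_of_odd {S : Type*} [Group S] [Finite S]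
    (h : ∀ (g : S) (m : ℕ), Odd m → g ^ m = 1 → g = 1) : IsPGroup 2 S := by
  intro g
  obtain ⟨k, m, hm, hk⟩ := Nat.exists_eq_two_pow_mul_odd (orderOf_pos g).ne'
  refine ⟨k, h _ m hm ?_⟩
  rw [← pow_mul, ← hk, pow_orderOf_eq_one]

set_option maxRecDepth 10000 in
theorem IsThreeTwo.perm_of_card_eq_three {X : Type*} (hX : Nat.card X = 3) :
    IsThreeTwo (Perm X) := by
  have key : ∀ g h : Perm (Fin 3), g ^ 6 = 1 ∧ (g ^ 3 = 1 → h ^ 3 = 1 → g * h = h * g) := by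
    decide
  have h3 : IsThreeTwo (Perm (Fin 3)) := ⟨fun g => ⟨1, (key g 1).1⟩, fun g h => (key g h).2⟩
  have : Finite X := Nat.finite_of_card_ne_zero (by omega)
  let e : X ≃ Fin 3 := Finite.equivFinOfCardEq hX
  exact h3.of_injective e.permCongrHom.toMonoidHom e.permCongrHom.injective

set_option maxRecDepth 10000 in
theorem mem_of_not_commute_perm_fin_four : ∀ a b : Perm (Fin 4), a ^ 3 = 1 → b ^ 3 = 1 →
    a * b ≠ b * a → swap 0 1 * swap 2 3 ∈
      [a * b, b * a, a * (a * b) * a⁻¹, a * b⁻¹, b⁻¹ * a, a * (a * b⁻¹) * a⁻¹] := by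
  decide

set_option maxRecDepth 10000 in
theorem IsThreeTwo.of_swap_mul_swap_notMem_fin (S : Subgroup (Perm (Fin 4)))
    (h : swap 0 1 * swap 2 3 ∉ S) : IsThreeTwo S := by
  have h12 : ∀ g : Perm (Fin 4), g ^ 12 = 1 := by decide
  refine ⟨fun g => ⟨2, Subtype.ext (h12 g)⟩, fun ⟨a, ha⟩ ⟨b, hb⟩ h1 h2 => ?_⟩
  by_contra hab
  refine h ?_
  have := mem_of_not_commute_perm_fin_four a b (by simpa using h1) (by simpa using h2)
    (by simpa using hab)
  simp only [List.mem_cons, List.not_mem_nil, or_false] at this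
  rcases this with h | h | h | h | h | h <;> rw [h]
  · exact S.mul_mem ha hb
  · exact S.mul_mem hb ha
  · exact S.mul_mem (S.mul_mem ha (S.mul_mem ha hb)) (S.inv_mem ha)
  · exact S.mul_mem ha (S.inv_mem hb)
  · exact S.mul_mem (S.inv_mem hb) ha
  · exact S.mul_mem (S.mul_mem ha (S.mul_mem ha (S.inv_mem hb))) (S.inv_mem ha)

/-- A group of permutations of four points missing some double transposition has at most
one Sylow 3-subgroup. -/
theorem IsThreeTwo.of_forall_ne {X : Type*} (e : Fin 4 ≃ X) (S : Subgroup (Perm X))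
    (h : ∀ g ∈ S, ¬ (g (e 0) = e 1 ∧ g (e 1) = e 0 ∧ g (e 2) = e 3 ∧ g (e 3) = e 2)) :
    IsThreeTwo S := by
  let f := e.symm.permCongrHom
  refine (IsThreeTwo.of_swap_mul_swap_notMem_fin (S.map f.toMonoidHom) ?_).of_injective
    (S.equivMapOfInjective _ f.injective).toMonoidHom (MulEquiv.injective _)
  rintro ⟨g, hg, hgf⟩
  have hi : ∀ i, g (e i) = e ((swap 0 1 * swap 2 3 : Perm (Fin 4)) i) := fun i => by
    rw [← hgf]; simp [f]
  refine h g hg ⟨?_, ?_, ?_, ?_⟩ <;> rw [hi] <;> rfl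

/-- Permutations preserving a colouring. -/
def colorStab {X C : Type*} (c : X → C) : Subgroup (Perm X) where
  carrier := {g | ∀ x, c (g x) = c x}
  one_mem' := by simp
  mul_mem' := by
    intro a b ha hb x
    rw [Perm.mul_apply, ha, hb]
  inv_mem' := by
    intro a ha x
    rw [← ha (a⁻¹ x), ← Perm.mul_apply, mul_inv_cancel, Perm.one_apply]

theorem mem_colorStab {X C : Type*} {c : X → C} {g : Perm X} :
    g ∈ colorStab c ↔ ∀ x, c (g x) = c x := Iff.rfl

/-- Permutations preserving a subset. -/
def setStab {X : Type*} (Δ : Set X) : Subgroup (Perm X) := colorStab (· ∈ Δ)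

theorem mem_setStab {X : Type*} {Δ : Set X} {g : Perm X} :
    g ∈ setStab Δ ↔ ∀ x, g x ∈ Δ ↔ x ∈ Δ := by
  simp [setStab, mem_colorStab]

theorem setStab_compl {X : Type*} (Δ : Set X) : setStab Δᶜ = setStab Δ := by
  ext g
  simp only [mem_setStab, Set.mem_compl_iff, not_iff_not]

/-- The affine permutations of an abelian group. -/
def affPerm (W : Type*) [AddCommGroup W] : Subgroup (Perm W) where
  carrier := {g | ∀ x y z, g (x - y + z) = g x - g y + g z}
  one_mem' := by simp
  mul_mem' := by
    intro a b ha hb x y z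
    simp only [Perm.mul_apply, hb x y z, ha (b x) (b y) (b z)]
  inv_mem' := by
    intro a ha x y z
    apply a.injective
    rw [ha]; simp

section Affine

variable {W : Type*} [AddCommGroup W]

/-- The linear part of an affine permutation. -/
def linearPart {g : Perm W} (hg : g ∈ affPerm W) : W →+ W where
  toFun x := g x - g 0
  map_zero' := sub_self _
  map_add' x y := by
    have := hg x 0 y
    rw [sub_zero] at this
    rw [this]; abel

theorem linearPart_apply {g : Perm W} (hg : g ∈ affPerm W) (x : W) :
    linearPart hg x = g x - g 0 := rfl

theorem linearPart_sub {g : Perm W} (hg : g ∈ affPerm W) (x y : W) :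
    linearPart hg (x - y) = g x - g y := by
  rw [map_sub, linearPart_apply, linearPart_apply, sub_sub_sub_cancel_right]

theorem aff_add {g : Perm W} (hg : g ∈ affPerm W) (x y : W) :
    g (x + y) = g x + linearPart hg y := by
  rw [← sub_eq_iff_eq_add', ← linearPart_sub hg, add_sub_cancel_left]

/-- The differences of elements of `Δ` generate `W`. -/
def Spans (Δ : Set W) : Prop :=
  ∀ K : AddSubgroup W, (∀ x ∈ Δ, ∀ y ∈ Δ, x - y ∈ K) → K = ⊤

theorem Spans.mono {Δ Γ : Set W} (h : Spans Δ) (hs : Δ ⊆ Γ) : Spans Γ :=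
  fun K hK => h K fun x hx y hy => hK x (hs hx) y (hs hy)

/-- `Δ` spans `W` even after removing any of its points. -/
def RobustlySpans (Δ : Set W) : Prop := ∀ z, Spans (Δ \ {z})

theorem RobustlySpans.spans {Δ : Set W} (h : RobustlySpans Δ) : Spans Δ :=
  (h 0).mono Set.sdiff_subset

theorem aff_eq_one {g : Perm W} (hg : g ∈ affPerm W) {Δ : Set W} (hΔ : Spans Δ)
    {x₀ : W} (hx₀ : x₀ ∈ Δ) (h : ∀ x ∈ Δ, g x = x) : g = 1 := by
  let K : AddSubgroup W := AddMonoidHom.eqLocus (linearPart hg) (AddMonoidHom.id W)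
  have hK : K = ⊤ := hΔ K fun x hx y hy => by
    change linearPart hg (x - y) = x - y
    rw [linearPart_sub, h x hx, h y hy]
  ext x
  have hx : x - x₀ ∈ K := hK ▸ AddSubgroup.mem_top _
  have hx' : linearPart hg (x - x₀) = x - x₀ := hx
  rw [linearPart_sub, h x₀ hx₀] at hx'
  simpa using hx'

theorem eq_top_of_lt_two_mul_card [Finite W] (K : AddSubgroup W)
    (h : Nat.card W < 2 * Nat.card K) : K = ⊤ := by
  obtain ⟨m, hm⟩ := K.card_addSubgroup_dvd_card
  have h1 : Nat.card W > 0 := Nat.card_pos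
  have : m < 2 := by
    by_contra hc
    have : Nat.card K * 2 ≤ Nat.card K * m := Nat.mul_le_mul_left _ (by omega)
    omega
  have : m = 1 := by
    interval_cases m
    · omega
    · rfl
  apply AddSubgroup.eq_top_of_card_eq
  rw [hm, this, mul_one]

theorem spans_of_card [Finite W] {Δ : Set W} (h : Nat.card W < 2 * Δ.ncard) : Spans Δ := by
  intro K hK
  apply eq_top_of_lt_two_mul_card
  obtain ⟨x, hx⟩ : Δ.Nonempty := by
    rw [Set.nonempty_iff_ne_empty]; rintro rfl; simp at h
  have : Δ.ncard ≤ (K : Set W).ncard :=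
    Set.ncard_le_ncard_of_injOn (fun y => y - x) (fun y hy => hK y hy x hx)
      (fun a _ b _ hab => sub_left_injective hab)
  have hc : Nat.card K = (K : Set W).ncard := Nat.card_coe_set_eq _
  omega

theorem robustlySpans_of_card [Finite W] {Δ : Set W} (h : Nat.card W + 2 < 2 * Δ.ncard) :
    RobustlySpans Δ := by
  intro z
  apply spans_of_card
  have := Set.ncard_le_ncard_sdiff_add_ncard Δ {z}
  rw [Set.ncard_singleton] at this
  omega

/-- The affine permutations preserving a set. -/
def affStab (Δ : Set W) : Subgroup (Perm W) := affPerm W ⊓ setStab Δ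

theorem mem_affStab {Δ : Set W} {g : Perm W} :
    g ∈ affStab Δ ↔ g ∈ affPerm W ∧ ∀ x, g x ∈ Δ ↔ x ∈ Δ := by
  rw [affStab, Subgroup.mem_inf, mem_setStab]

end Affine

/-- Restriction of permutations to an invariant set. -/
def restrictHom {X : Type*} (S : Subgroup (Perm X)) (Y : Set X)
    (h : ∀ g ∈ S, ∀ x ∈ Y, g x ∈ Y) : S →* Perm Y where
  toFun g := (g : Perm X).subtypePerm fun x =>
    ⟨fun hx => by simpa using h _ (S.inv_mem g.2) _ hx, h _ g.2 x⟩
  map_one' := by ext; simp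
  map_mul' a b := by ext; rfl

/-- Two subgroups of permutations, the first of which restricts faithfully into the second. -/
theorem exists_injective_of_restrict {X : Type*} (S : Subgroup (Perm X)) (Y : Set X)
    (h : ∀ g ∈ S, ∀ x ∈ Y, g x ∈ Y) (h1 : ∀ g ∈ S, (∀ x ∈ Y, g x = x) → g = 1)
    (T : Subgroup (Perm Y)) (hT : ∀ g : S, restrictHom S Y h g ∈ T) :
    ∃ f : S →* T, Function.Injective f := by
  refine ⟨(restrictHom S Y h).codRestrict T hT, (injective_iff_map_eq_one _).2 fun g hg => ?_⟩
  apply Subtype.ext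
  refine h1 _ g.2 fun x hx => ?_
  have : restrictHom S Y h g ⟨x, hx⟩ = ⟨x, hx⟩ := by
    have := congrArg Subtype.val hg
    simp only [MonoidHom.codRestrict_apply] at this
    rw [this]; rfl
  exact congrArg Subtype.val this

theorem Spans.nonempty {W : Type*} [AddCommGroup W] [Nontrivial W] {Δ : Set W} (h : Spans Δ) :
    Δ.Nonempty := by
  rw [Set.nonempty_iff_ne_empty]
  rintro rfl
  exact bot_ne_top (h ⊥ (by simp))

section Step

variable {W : Type*} [AddCommGroup W] {U : AddSubgroup W}

theorem apply_eq_of_mem_affStab_insert [Nontrivial U] (hU : IsCoatom U) {v : W} (hv : v ∉ U)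
    {Δ : Set U} (hΔ : RobustlySpans Δ) {g : Perm W}
    (hg : g ∈ affStab (insert v (Subtype.val '' Δ))) : g v = v := by
  obtain ⟨ha, hs⟩ := mem_affStab.1 hg
  rcases (hs v).2 (Set.mem_insert _ _) with h | ⟨x, hx, hxv⟩
  · exact h
  exfalso
  have hgx : ∀ y ∈ insert v (Subtype.val '' Δ), y ≠ g v → ∃ u : U, g u = y := by
    intro y hy hyv
    have hy' : g (g⁻¹ y) = y := by rw [← Perm.mul_apply, mul_inv_cancel, Perm.one_apply]
    rcases (hs (g⁻¹ y)).1 (by rwa [hy']) with h | ⟨u, -, hu⟩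
    · rw [h] at hy'
      exact absurd hy'.symm hyv
    · exact ⟨u, by rw [hu, hy']⟩
  let K : AddSubgroup W := U.map (linearPart ha)
  have hK : ∀ y z : W, (∃ u : U, g u = y) → (∃ u : U, g u = z) → y - z ∈ K := by
    rintro _ _ ⟨a, rfl⟩ ⟨b, rfl⟩
    exact ⟨a - b, U.sub_mem a.2 b.2, linearPart_sub ha _ _⟩
  have hmem : ∀ y ∈ Δ \ {x}, ∃ u : U, g u = y := fun y hy =>
    hgx y (Or.inr ⟨y, hy.1, rfl⟩) fun h => hy.2 (Subtype.ext (by rw [h, hxv]))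
  have hUK : U ≤ K := by
    have := hΔ x (K.comap U.subtype) fun y hy z hz => hK _ _ (hmem y hy) (hmem z hz)
    intro u hu
    have h2 : (⟨u, hu⟩ : U) ∈ K.comap U.subtype := this ▸ AddSubgroup.mem_top _
    exact h2
  obtain ⟨y, hy⟩ := (hΔ x).nonempty
  have hvK : v ∈ K := by
    have h1 := hK v y (hgx v (Set.mem_insert _ _) fun h => hv (by rw [h, ← hxv]; exact x.2))
      (hmem y hy)
    have h2 := K.add_mem h1 (hUK y.2)
    rwa [sub_add_cancel] at h2
  have hKtop : K = ⊤ := hU.2 _ (lt_of_le_of_ne hUK fun h => hv (h ▸ hvK))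
  obtain ⟨u, hu, huv⟩ : linearPart ha v ∈ K := hKtop ▸ AddSubgroup.mem_top _
  rw [linearPart_apply, linearPart_apply, sub_left_inj] at huv
  exact hv (g.injective huv ▸ hu)

theorem apply_mem_of_mem_affStab_insert [Nontrivial U] (hU : IsCoatom U) {v : W} (hv : v ∉ U)
    {Δ : Set U} (hΔ : RobustlySpans Δ) {g : Perm W}
    (hg : g ∈ affStab (insert v (Subtype.val '' Δ))) :
    (∀ x : U, x ∈ Δ → ∃ y : U, y ∈ Δ ∧ g x = y) ∧ ∀ x ∈ U, g x ∈ U := by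
  have hgv := apply_eq_of_mem_affStab_insert hU hv hΔ hg
  obtain ⟨ha, hs⟩ := mem_affStab.1 hg
  have h1 : ∀ x : U, x ∈ Δ → ∃ y : U, y ∈ Δ ∧ g x = y := fun x hx => by
    rcases (hs x).2 (Or.inr ⟨x, hx, rfl⟩) with h | ⟨y, hy, hyx⟩
    · exact absurd x.2 ((g.injective (h.trans hgv.symm) : (x : W) = v) ▸ hv)
    · exact ⟨y, hy, hyx.symm⟩
  refine ⟨h1, fun x hx => ?_⟩
  have hK := hΔ.spans ((U.comap (linearPart ha)).comap U.subtype) fun a haΔ b hb => by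
    obtain ⟨a', -, ha'⟩ := h1 a haΔ
    obtain ⟨b', -, hb'⟩ := h1 b hb
    change linearPart ha (a - b) ∈ U
    rw [linearPart_sub, ha', hb']
    exact U.sub_mem a'.2 b'.2
  obtain ⟨y, hy⟩ := hΔ.spans.nonempty
  obtain ⟨z, -, hz⟩ := h1 y hy
  have h2 : (⟨x, hx⟩ - y : U) ∈ (U.comap (linearPart ha)).comap U.subtype :=
    hK ▸ AddSubgroup.mem_top _
  have h3 : linearPart ha (x - y) ∈ U := h2
  rw [linearPart_sub, hz] at h3
  simpa using U.add_mem h3 z.2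

/-- Adding to a robustly spanning subset of a hyperplane a point outside does not enlarge
the stabilizer. -/
theorem exists_injective_affStab_insert [Nontrivial U] (hU : IsCoatom U) {v : W} (hv : v ∉ U)
    {Δ : Set U} (hΔ : RobustlySpans Δ) :
    ∃ f : affStab (insert v (Subtype.val '' Δ)) →* affStab Δ, Function.Injective f := by
  have key := fun g hg => apply_mem_of_mem_affStab_insert hU hv hΔ (g := g) hg
  refine exists_injective_of_restrict _ (U : Set W) (fun g hg => (key g hg).2)
    (fun g hg h => ?_) _ fun g => mem_affStab.2 ⟨fun x y z => Subtype.ext (g.2.1 x y z), ?_⟩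
  · refine aff_eq_one hg.1 (Δ := insert v U) (fun K hK => ?_) (Or.inr U.zero_mem) ?_
    · have h0 := fun x (hx : x ∈ insert v (U : Set W)) => hK x hx 0 (Or.inr U.zero_mem)
      simp only [sub_zero] at h0
      exact hU.2 _ (lt_of_le_of_ne (fun x hx => h0 x (Or.inr hx))
        fun h => hv (h ▸ h0 v (Or.inl rfl)))
    · rintro x (rfl | hx)
      · exact apply_eq_of_mem_affStab_insert hU hv hΔ hg
      · exact h x hx
  · have himp : ∀ g : affStab (insert v (Subtype.val '' Δ)), ∀ x : U, x ∈ Δ →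
        restrictHom _ (U : Set W) (fun g hg => (key g hg).2) g x ∈ Δ := fun g x hx => by
      obtain ⟨y, hy, hxy⟩ := (key _ g.2).1 x hx
      rwa [show restrictHom _ (U : Set W) (fun g hg => (key g hg).2) g x = y from Subtype.ext hxy]
    refine fun x => ⟨fun hx => ?_, himp g x⟩
    have := himp g⁻¹ _ hx
    rwa [map_inv, ← Perm.mul_apply, inv_mul_cancel, Perm.one_apply] at this

end Step

section Transport

variable {W W' : Type*} [AddCommGroup W] [AddCommGroup W']

theorem permCongr_mem_affPerm (e : W ≃+ W') {g : Perm W} (hg : g ∈ affPerm W) :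
    e.toEquiv.permCongr g ∈ affPerm W' := by
  intro x y z
  simp [hg (e.symm x) (e.symm y) (e.symm z)]

theorem exists_injective_affStab_preimage (e : W ≃+ W') (Δ : Set W') :
    ∃ f : affStab (e ⁻¹' Δ) →* affStab Δ, Function.Injective f := by
  refine ⟨((e.toEquiv.permCongrHom.toMonoidHom).comp (Subgroup.subtype _)).codRestrict _
    fun g => ?_, ?_⟩
  · obtain ⟨h1, h2⟩ := mem_affStab.1 g.2
    refine mem_affStab.2 ⟨permCongr_mem_affPerm e h1, fun x => ?_⟩
    simpa using h2 (e.symm x)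
  · intro a b hab
    apply Subtype.ext
    apply e.toEquiv.permCongrHom.injective
    exact congrArg Subtype.val hab

theorem Spans.preimage (e : W ≃+ W') {Δ : Set W'} (h : Spans Δ) : Spans (e ⁻¹' Δ) := by
  intro K hK
  have := h (K.map e.toAddMonoidHom) fun x hx y hy =>
    ⟨e.symm x - e.symm y, hK _ (by simpa using hx) _ (by simpa using hy), by simp⟩
  rw [eq_top_iff]
  intro x _
  obtain ⟨y, hy, hyx⟩ : e x ∈ K.map e.toAddMonoidHom := this ▸ AddSubgroup.mem_top _
  exact e.injective hyx ▸ hy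

theorem RobustlySpans.preimage (e : W ≃+ W') {Δ : Set W'} (h : RobustlySpans Δ) :
    RobustlySpans (e ⁻¹' Δ) := fun z =>
  ((h (e z)).preimage e).mono fun x hx => ⟨hx.1, fun hz => hx.2 (by rw [hz]; rfl)⟩

end Transport

/-- Two subsets with small affine stabilizers from which such subsets of larger groups
can be built. -/
def HasSeed (p : ℕ) (W : Type*) [AddCommGroup W] : Prop :=
  ∃ Δ₁ Δ₂ : Set W, IsPGroup 2 (affStab Δ₁) ∧ IsThreeTwo (affStab Δ₂) ∧
    RobustlySpans Δ₁ ∧ RobustlySpans Δ₂ ∧ 2 ≤ Δ₁.ncard ∧ 2 ≤ Δ₂.ncard ∧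
    2 * (Δ₁.ncard + 3) ≤ p * Nat.card W ∧ 2 * (Δ₂.ncard + 3) ≤ p * Nat.card W ∧
    Δ₁.ncard ≠ Δ₂.ncard ∧ Δ₁.ncard + Δ₂.ncard ≠ Nat.card W ∧ 2 * Δ₂.ncard ≠ Nat.card W

theorem HasSeed.of_addEquiv {p : ℕ} {W W' : Type*} [AddCommGroup W] [AddCommGroup W']
    (e : W ≃+ W') (h : HasSeed p W') : HasSeed p W := by
  obtain ⟨Δ₁, Δ₂, h1, h2, h3, h4, h5⟩ := h
  have hc : ∀ Δ : Set W', (e ⁻¹' Δ).ncard = Δ.ncard := fun Δ =>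
    Set.ncard_preimage_of_injective_subset_range e.injective (by simp [e.surjective.range_eq])
  refine ⟨e ⁻¹' Δ₁, e ⁻¹' Δ₂, ?_, ?_, h3.preimage e, h4.preimage e, ?_⟩
  · obtain ⟨f, hf⟩ := exists_injective_affStab_preimage e Δ₁
    exact h1.of_injective f hf
  · obtain ⟨f, hf⟩ := exists_injective_affStab_preimage e Δ₂
    exact h2.of_injective f hf
  · rwa [hc, hc, Nat.card_congr e.toEquiv]

theorem isCoatom_of_card {W : Type*} [AddCommGroup W] [Finite W] {U : AddSubgroup W} {p : ℕ}
    (hp : p.Prime) (h : Nat.card W = Nat.card U * p) : IsCoatom U := by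
  refine ⟨?_, fun K hK => ?_⟩
  · rintro rfl
    rw [AddSubgroup.card_top] at h
    have : Nat.card W > 0 := Nat.card_pos
    have := hp.two_le
    nlinarith
  · obtain ⟨a, ha⟩ := AddSubgroup.card_dvd_of_le hK.le
    obtain ⟨b, hb⟩ := K.card_addSubgroup_dvd_card
    have hU : 0 < Nat.card U := Nat.card_pos
    have hab : a * b = p := by
      apply Nat.eq_of_mul_eq_mul_left hU
      rw [← h, hb, ha, mul_assoc]
    rcases (Nat.dvd_prime hp).1 ⟨b, hab.symm⟩ with rfl | rfl
    · exact absurd (AddSubgroup.eq_of_le_of_card_ge hK.le (by omega)) hK.ne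
    · apply AddSubgroup.eq_top_of_card_eq
      rw [ha, h]

theorem exists_addSubgroup_card {W : Type*} [AddCommGroup W] {p d : ℕ} (hp : p.Prime)
    (h : Nat.card W = p ^ (d + 1)) : ∃ U : AddSubgroup W, Nat.card U = p ^ d := by
  have := Fact.mk hp
  have : Finite W := Nat.finite_of_card_ne_zero (by rw [h]; exact pow_ne_zero _ hp.ne_zero)
  have : Finite (Multiplicative W) := this
  obtain ⟨K, hK⟩ := Sylow.exists_subgroup_card_pow_prime (G := Multiplicative W) p (n := d)
    (by rw [show Nat.card (Multiplicative W) = Nat.card W from rfl, h]; exact ⟨p, pow_succ _ _⟩)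
  exact ⟨Subgroup.toAddSubgroup' K, hK⟩

theorem HasSeed.step {p : ℕ} (hp : p.Prime) {W : Type*} [AddCommGroup W] [Finite W]
    {U : AddSubgroup W} [Nontrivial U] (hcard : Nat.card W = Nat.card U * p)
    (h : HasSeed p U) : HasSeed p W := by
  obtain ⟨Δ₁, Δ₂, h1, h2, h3, h4, h5, h6, h7, h8, h9, h10, h11⟩ := h
  have hU := isCoatom_of_card hp hcard
  obtain ⟨v, hv⟩ : ∃ v, v ∉ U := by
    by_contra hc
    push Not at hc
    exact hU.1 (eq_top_iff.2 fun x _ => hc x)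
  have hc : ∀ Δ : Set U, (insert v (Subtype.val '' Δ))ᶜ.ncard + (Δ.ncard + 1) = Nat.card W := by
    intro Δ
    rw [← Set.ncard_add_ncard_compl (insert v (Subtype.val '' Δ)), Set.ncard_insert_of_notMem,
      Set.ncard_image_of_injective _ Subtype.val_injective, add_comm]
    rintro ⟨x, -, rfl⟩
    exact hv x.2
  have hstab : ∀ Δ : Set W, affStab Δᶜ = affStab Δ := fun Δ => by
    rw [affStab, affStab, setStab_compl]
  have hc1 := hc Δ₁
  have hc2 := hc Δ₂
  rw [mul_comm p, ← hcard] at h7 h8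
  have hp2 : 2 * Nat.card W ≤ p * Nat.card W := Nat.mul_le_mul_right _ hp.two_le
  refine ⟨(insert v (Subtype.val '' Δ₁))ᶜ, (insert v (Subtype.val '' Δ₂))ᶜ, ?_, ?_,
    robustlySpans_of_card (by omega), robustlySpans_of_card (by omega), by omega, by omega,
    by omega, by omega, by omega, by omega, by omega⟩
  · rw [hstab]
    obtain ⟨f, hf⟩ := exists_injective_affStab_insert hU hv h3
    exact h1.of_injective f hf
  · rw [hstab]
    obtain ⟨f, hf⟩ := exists_injective_affStab_insert hU hv h4
    exact h2.of_injective f hf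

theorem HasSeed.of_le.{u} {p : ℕ} (hp : p.Prime) {d₀ : ℕ} (hd₀ : 0 < d₀)
    (h₀ : ∀ (W : Type u) [AddCommGroup W], (∀ w : W, p • w = 0) → Nat.card W = p ^ d₀ →
      HasSeed p W)
    {d : ℕ} (hd : d₀ ≤ d) : ∀ (W : Type u) [AddCommGroup W], (∀ w : W, p • w = 0) →
      Nat.card W = p ^ d → HasSeed p W := by
  induction d, hd using Nat.le_induction with
  | base => exact h₀
  | succ d hd ih =>
    intro W _ hW hcard
    obtain ⟨U, hUc⟩ := exists_addSubgroup_card hp hcard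
    have : Finite W := Nat.finite_of_card_ne_zero (by rw [hcard]; exact pow_ne_zero _ hp.ne_zero)
    have : Nontrivial U := Finite.one_lt_card_iff_nontrivial.1
      (by rw [hUc]; exact Nat.one_lt_pow (by omega) hp.one_lt)
    exact HasSeed.step hp (by rw [hcard, hUc, pow_succ])
      (ih U (fun w => Subtype.ext (by simpa using hW w)) hUc)

theorem nonempty_linearEquiv_of_card_eq {p : ℕ} [Fact p.Prime] {W W' : Type*} [AddCommGroup W]
    [AddCommGroup W'] [Module (ZMod p) W] [Module (ZMod p) W'] [Finite W] [Finite W']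
    (h : Nat.card W = Nat.card W') : Nonempty (W ≃ₗ[ZMod p] W') := by
  rw [← FiniteField.pow_finrank_eq_natCard p, ← FiniteField.pow_finrank_eq_natCard p] at h
  exact FiniteDimensional.nonempty_linearEquiv_of_finrank_eq
    (Nat.pow_right_injective (Fact.out : p.Prime).two_le h)

/-- A finite elementary abelian group is determined by its order. -/
theorem exists_addEquiv_of_card_eq {p : ℕ} (hp : p.Prime) {W W' : Type*} [AddCommGroup W]
    [AddCommGroup W'] (hW : ∀ w : W, p • w = 0) (hW' : ∀ w : W', p • w = 0) [Finite W] [Finite W']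
    (h : Nat.card W = Nat.card W') : Nonempty (W ≃+ W') := by
  have := Fact.mk hp
  let _ : Module (ZMod p) W := AddCommGroup.zmodModule hW
  let _ : Module (ZMod p) W' := AddCommGroup.zmodModule hW'
  obtain ⟨e⟩ := nonempty_linearEquiv_of_card_eq (p := p) h
  exact ⟨e.toAddEquiv⟩

theorem apply_eq_of_odd {X : Type*} {g : Perm X} {m k : ℕ} (hm : Odd m) (hg : g ^ m = 1) {x : X}
    (h : (g ^ 2 ^ k) x = x) : g x = x := by
  have h2 : (g ^ m) x = x := by rw [hg, Perm.one_apply]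
  exact smul_eq_of_pow_two_pow_of_odd (g := g) (x := x) hm h h2

theorem apply_eq_of_mem_pair {X : Type*} {g : Perm X} {m : ℕ} (hm : Odd m) (hg : g ^ m = 1)
    {u v : X} (hu : g u = u ∨ g u = v) (hv : g v = u ∨ g v = v) : g u = u := by
  rcases hu with hu | hu
  · exact hu
  · refine apply_eq_of_odd (k := 1) hm hg ?_
    rw [pow_one, pow_two, Perm.mul_apply, hu]
    rcases hv with hv | hv
    · exact hv
    · rw [hv]; exact g.injective (hv.trans hu.symm)

section

variable {W : Type*} [AddCommGroup W]

theorem affStab_compl (Δ : Set W) : affStab Δᶜ = affStab Δ := by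
  rw [affStab, affStab, setStab_compl]

theorem isThreeTwo_affStab_of_ncard_eq_three {Δ : Set W} (hΔ : Spans Δ) (h3 : Δ.ncard = 3) :
    IsThreeTwo (affStab Δ) := by
  obtain ⟨x₀, hx₀⟩ : Δ.Nonempty := Set.nonempty_of_ncard_ne_zero (by omega)
  obtain ⟨f, hf⟩ := exists_injective_of_restrict (affStab Δ) Δ
    (fun g hg x hx => ((mem_affStab.1 hg).2 x).2 hx)
    (fun g hg h => aff_eq_one hg.1 hΔ hx₀ h) ⊤ fun _ => Subgroup.mem_top _
  exact (IsThreeTwo.perm_of_card_eq_three h3).of_injective ((Subgroup.subtype _).comp f)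
    (Subtype.val_injective.comp hf)

theorem isPGroup_affStab [Finite W] {Δ : Set W}
    (h : ∀ (g : Perm W) (m : ℕ), Odd m → g ^ m = 1 → g ∈ affPerm W → (∀ x, g x ∈ Δ ↔ x ∈ Δ) →
      g = 1) : IsPGroup 2 (affStab Δ) :=
  isPGroup_two_of_odd fun g m hm hg =>
    Subtype.ext (h g m hm (congrArg Subtype.val hg) (mem_affStab.1 g.2).1 (mem_affStab.1 g.2).2)

end

section Prime

variable {p : ℕ} [Fact p.Prime]

theorem spans_zmod {Δ : Set (ZMod p)} {x y : ZMod p} (hx : x ∈ Δ) (hy : y ∈ Δ) (h : x ≠ y) :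
    Spans Δ := by
  intro K hK
  rcases AddSubgroup.eq_bot_or_eq_top_of_prime_card K
    (hp := ⟨by rw [Nat.card_zmod]; exact Fact.out⟩) with h1 | h1
  · have := hK x hx y hy
    rw [h1, AddSubgroup.mem_bot, sub_eq_zero] at this
    exact absurd this h
  · exact h1

theorem robustlySpans_zmod {Δ : Set (ZMod p)} (h : 3 ≤ Δ.ncard) : RobustlySpans Δ := by
  intro z
  have h1 := Set.ncard_le_ncard_sdiff_add_ncard Δ {z}
  rw [Set.ncard_singleton] at h1
  obtain ⟨x, hx, y, hy, hxy⟩ := (Set.one_lt_ncard (s := Δ \ {z})).1 (by omega)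
  exact spans_zmod hx hy hxy

theorem isPGroup_affStab_zmod : IsPGroup 2 (affStab ({0, 1} : Set (ZMod p))) := by
  refine isPGroup_affStab fun g m hm hg ha hs => ?_
  have h0 := (hs 0).2 (by simp)
  have h1 := (hs 1).2 (by simp)
  have key : g 0 = 0 := apply_eq_of_mem_pair hm hg h0 h1
  have key1 : g 1 = 1 := apply_eq_of_mem_pair hm hg h1.symm h0.symm
  refine aff_eq_one ha (Δ := {0, 1})
    (spans_zmod (x := 0) (y := 1) (by simp) (by simp) zero_ne_one) (x₀ := 0) (by simp) ?_
  rintro x (rfl | rfl)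
  · exact key
  · exact key1

theorem isPGroup_affStab_zmod_five : IsPGroup 2 (affStab ({0} : Set (ZMod 5))) := by
  refine isPGroup_affStab fun g m hm hg ha hs => ?_
  have h0 : g 0 = 0 := (hs 0).2 rfl
  have hL : ∀ x, g x = x * g 1 := fun x => by
    have h1 : ∀ y, linearPart ha y = g y := fun y => by rw [linearPart_apply, h0, sub_zero]
    have : x = x.val • (1 : ZMod 5) := by simp
    rw [← h1, ← h1]
    conv_lhs => rw [this]
    rw [map_nsmul, nsmul_eq_mul, ZMod.natCast_val, ZMod.cast_id]
  have h1 : g 1 = 1 := by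
    refine apply_eq_of_odd (k := 2) hm hg ?_
    have hne : g 1 ≠ 0 := fun h => absurd (g.injective (h.trans h0.symm)) (by decide)
    change g (g (g (g 1))) = 1
    rw [hL (g (g (g 1))), hL (g (g 1)), hL (g 1)]
    generalize g 1 = u at hne ⊢
    decide +revert
  ext x
  rw [hL, h1, mul_one, Perm.one_apply]

theorem hasSeed_zmod (hp : 5 ≤ p) : HasSeed p (ZMod p) := by
  have hpp : p.Prime := Fact.out
  have hc : Nat.card (ZMod p) = p := Nat.card_zmod p
  have h1 : ({0, 1}ᶜ : Set (ZMod p)).ncard + 2 = p := by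
    have := Set.ncard_add_ncard_compl ({0, 1} : Set (ZMod p))
    rw [Set.ncard_pair zero_ne_one, hc] at this
    omega
  by_cases h5 : p = 5
  · subst h5
    have h2 : ({0}ᶜ : Set (ZMod 5)).ncard = 4 := by
      have := Set.ncard_add_ncard_compl ({0} : Set (ZMod 5))
      rw [Set.ncard_singleton, hc] at this
      omega
    refine ⟨{0, 1}ᶜ, {0}ᶜ, ?_, ?_, robustlySpans_zmod (by omega), robustlySpans_zmod (by omega),
      by omega, by omega, by omega, by omega, by omega, by omega, by omega⟩
    · rw [affStab_compl]; exact isPGroup_affStab_zmod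
    · rw [affStab_compl]; exact isPGroup_affStab_zmod_five.isThreeTwo
  · have h6 : p ≠ 6 := by rintro rfl; revert hpp; decide
    obtain ⟨Δ, hΔ⟩ := Set.exists_subset_card_eq (s := (Set.univ : Set (ZMod p))) (n := 3)
      (by rw [Set.ncard_univ, hc]; omega)
    have hr : RobustlySpans Δ := robustlySpans_zmod hΔ.2.ge
    have hmul : 7 * p ≤ p * p := Nat.mul_le_mul_right _ (by omega)
    refine ⟨{0, 1}ᶜ, Δ, ?_, isThreeTwo_affStab_of_ncard_eq_three hr.spans hΔ.2,
      robustlySpans_zmod (by omega), hr, by omega, by omega, by rw [hc]; omega,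
      by rw [hc]; omega, by omega, by omega, by omega⟩
    rw [affStab_compl]; exact isPGroup_affStab_zmod

end Prime

section Three

/-- A parallelogram in the affine plane of order 3. -/
def parallelogram : Set (ZMod 3 × ZMod 3) := {x | x.1 ≠ 2 ∧ x.2 ≠ 2}

instance : DecidablePred (· ∈ parallelogram) := fun x =>
  inferInstanceAs (Decidable (x.1 ≠ 2 ∧ x.2 ≠ 2))

theorem eq_top_of_mem_zmod_prod {n : ℕ} [NeZero n] {K : AddSubgroup (ZMod n × ZMod n)}
    (h1 : (1, 0) ∈ K) (h2 : (0, 1) ∈ K) : K = ⊤ := by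
  rw [eq_top_iff]
  rintro ⟨x, y⟩ -
  have : ((x, y) : ZMod n × ZMod n) = x.val • (1, 0) + y.val • (0, 1) := by simp
  rw [this]
  exact K.add_mem (K.nsmul_mem h1 _) (K.nsmul_mem h2 _)

theorem robustlySpans_parallelogram : RobustlySpans parallelogram := by
  have key : ∀ z : ZMod 3 × ZMod 3, ∀ w : ZMod 3 × ZMod 3, w = (1, 0) ∨ w = (0, 1) →
      ∃ x : ZMod 3 × ZMod 3, (x ∈ parallelogram ∧ x ≠ z) ∧
      ∃ y : ZMod 3 × ZMod 3, (y ∈ parallelogram ∧ y ≠ z) ∧ x - y = w := by decide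
  intro z K hK
  apply eq_top_of_mem_zmod_prod
  · obtain ⟨x, hx, y, hy, h⟩ := key z _ (Or.inl rfl)
    exact h ▸ hK x hx y hy
  · obtain ⟨x, hx, y, hy, h⟩ := key z _ (Or.inr rfl)
    exact h ▸ hK x hx y hy

/-- The vertices of `parallelogram`. -/
def parallelogramVertex : Fin 4 → ZMod 3 × ZMod 3 := ![(0, 0), (1, 0), (0, 1), (1, 1)]

theorem mem_parallelogram : ∀ x, x ∈ parallelogram ↔ ∃ i, x = parallelogramVertex i := by decide

theorem iterate_parallelogramVertex : ∀ i j k l : Fin 4,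
    i ≠ j → i ≠ k → i ≠ l →
    parallelogramVertex j - parallelogramVertex i + parallelogramVertex k =
      parallelogramVertex l →
    ∀ a, ![i, j, k, l] (![i, j, k, l] (![i, j, k, l] (![i, j, k, l] a))) = a := by
  decide

theorem isPGroup_affStab_parallelogram : IsPGroup 2 (affStab parallelogram) := by
  refine isPGroup_affStab fun g m hm hg ha hs => ?_
  have h : ∀ i, ∃ j, g (parallelogramVertex i) = parallelogramVertex j := fun i =>
    (mem_parallelogram _).1 ((hs _).2 ((mem_parallelogram _).2 ⟨i, rfl⟩))
  choose σ hσ using h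
  have hne : ∀ i, i ≠ 0 → σ 0 ≠ σ i := fun i hi h => by
    have h1 := g.injective ((hσ 0).trans ((congrArg _ h).trans (hσ i).symm))
    revert hi h1
    clear * -
    revert i
    decide
  have hrel := ha (parallelogramVertex 1) (parallelogramVertex 0) (parallelogramVertex 2)
  rw [show parallelogramVertex 1 - parallelogramVertex 0 + parallelogramVertex 2 =
    parallelogramVertex 3 by decide, hσ, hσ, hσ, hσ] at hrel
  have key := iterate_parallelogramVertex _ _ _ _ (hne 1 (by decide)) (hne 2 (by decide))
    (hne 3 (by decide)) hrel.symm
  rw [show ![σ 0, σ 1, σ 2, σ 3] = σ from (List.ofFn_inj.1 rfl)] at key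
  refine aff_eq_one ha robustlySpans_parallelogram.spans (x₀ := (0, 0)) (by decide) fun x hx => ?_
  obtain ⟨i, rfl⟩ := (mem_parallelogram _).1 hx
  refine apply_eq_of_odd (k := 2) hm hg ?_
  change g (g (g (g _))) = _
  rw [hσ, hσ, hσ, hσ, key]

theorem hasSeed_three : HasSeed 3 (ZMod 3 × ZMod 3) := by
  have hc : Nat.card (ZMod 3 × ZMod 3) = 9 := by simp
  have h1 : parallelogram.ncard = 4 := by
    rw [Set.ncard_eq_toFinset_card']; decide
  have h2 : ({(0, 0), (1, 0), (0, 1)} : Set (ZMod 3 × ZMod 3)).ncard = 3 := by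
    rw [Set.ncard_eq_toFinset_card']; decide
  have h3 : ({(0, 0), (1, 0), (0, 1)}ᶜ : Set (ZMod 3 × ZMod 3)).ncard = 6 := by
    have := Set.ncard_add_ncard_compl ({(0, 0), (1, 0), (0, 1)} : Set (ZMod 3 × ZMod 3))
    omega
  refine ⟨parallelogram, {(0, 0), (1, 0), (0, 1)}ᶜ, isPGroup_affStab_parallelogram, ?_,
    robustlySpans_parallelogram, robustlySpans_of_card (by omega), by omega, by omega, by omega,
    by omega, by omega, by omega, by omega⟩
  rw [affStab_compl]
  refine isThreeTwo_affStab_of_ncard_eq_three (fun K hK => eq_top_of_mem_zmod_prod ?_ ?_) h2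
  · simpa using hK (1, 0) (by simp) (0, 0) (by simp)
  · simpa using hK (0, 1) (by simp) (0, 0) (by simp)

end Three

section Two

/-- The elementary abelian group of order 16, as a sum of two groups of order 4. -/
abbrev Sixteen := (ZMod 2 × ZMod 2) × (ZMod 2 × ZMod 2)

/-- The union of two complementary planes. -/
def cross : Set Sixteen := {x | x.1 = 0 ∨ x.2 = 0}

/-- The union of two complementary planes and another point. -/
def crossPoint : Set Sixteen := {x | x.1 = 0 ∨ x.2 = 0 ∨ x = ((1, 0), (1, 0))}

instance : DecidablePred (· ∈ cross) := fun x =>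
  inferInstanceAs (Decidable (x.1 = 0 ∨ x.2 = 0))

instance : DecidablePred (· ∈ crossPoint) := fun x =>
  inferInstanceAs (Decidable (x.1 = 0 ∨ x.2 = 0 ∨ x = ((1, 0), (1, 0))))

theorem robustlySpans_cross : RobustlySpans cross := by
  intro z K hK
  have key : ∀ z w : ZMod 2 × ZMod 2, ∃ x y, x ≠ z ∧ y ≠ z ∧ x - y = w := by decide
  rw [eq_top_iff]
  rintro ⟨u, v⟩ -
  obtain ⟨x, y, hx, hy, hu⟩ := key z.1 u
  obtain ⟨x', y', hx', hy', hv⟩ := key z.2 v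
  have h1 := hK (x, 0) ⟨Or.inr rfl, fun h => hx (congrArg Prod.fst h)⟩ (y, 0)
    ⟨Or.inr rfl, fun h => hy (congrArg Prod.fst h)⟩
  have h2 := hK (0, x') ⟨Or.inl rfl, fun h => hx' (congrArg Prod.snd h)⟩ (0, y')
    ⟨Or.inl rfl, fun h => hy' (congrArg Prod.snd h)⟩
  simpa [hu, hv] using K.add_mem h1 h2

theorem cross_subset_crossPoint : cross ⊆ crossPoint := fun _ hx =>
  hx.elim Or.inl fun h => Or.inr (Or.inl h)

theorem robustlySpans_crossPoint : RobustlySpans crossPoint := fun z =>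
  (robustlySpans_cross z).mono (Set.sdiff_subset_sdiff_left cross_subset_crossPoint)

set_option maxRecDepth 10000 in
theorem eq_zero_of_cross : ∀ o ∈ cross,
    (∀ x ∈ cross, ∃ y ∈ cross, y ≠ o ∧ y ≠ x ∧ x - o + y ∈ cross) → o = 0 := by decide

set_option maxRecDepth 10000 in
theorem zero_cross : ∀ x ∈ cross, ∃ y ∈ cross, y ≠ 0 ∧ y ≠ x ∧ x - 0 + y ∈ cross := by decide

theorem apply_zero_of_mem_affStab_cross {g : Perm Sixteen} (hg : g ∈ affStab cross) : g 0 = 0 := by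
  obtain ⟨ha, hs⟩ := mem_affStab.1 hg
  refine eq_zero_of_cross _ ((hs 0).2 (by decide)) fun x hx => ?_
  have hx' : g (g⁻¹ x) = x := by rw [← Perm.mul_apply, mul_inv_cancel, Perm.one_apply]
  obtain ⟨y, hy, hy0, hyx, hxy⟩ := zero_cross (g⁻¹ x) ((hs _).1 (by rwa [hx']))
  refine ⟨g y, (hs y).2 hy, fun h => hy0 (g.injective h), fun h => hyx (g.injective ?_), ?_⟩
  · rw [hx', h]
  · have := (hs _).2 hxy
    rwa [ha, hx'] at this

set_option maxRecDepth 10000 in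
theorem fst_or_snd_cross : ∀ x : Sixteen, x ∈ cross → ∀ y : Sixteen, y ∈ cross →
    x ≠ 0 ∧ x + y ∈ cross → (x.2 = 0 ∧ y.2 = 0) ∨ (x.1 = 0 ∧ y.1 = 0) := by
  decide

theorem apply_add_of_mem_affStab_cross {g : Perm Sixteen} (hg : g ∈ affStab cross)
    (x y : Sixteen) : g (x + y) = g x + g y := by
  have := aff_add (mem_affStab.1 hg).1 x y
  rwa [linearPart_apply, apply_zero_of_mem_affStab_cross hg, sub_zero] at this

theorem apply_ne_zero_of_mem_affStab_cross {g : Perm Sixteen} (hg : g ∈ affStab cross)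
    {x : Sixteen} (hx : x ≠ 0) : g x ≠ 0 := fun h =>
  hx (g.injective (h.trans (apply_zero_of_mem_affStab_cross hg).symm))

/-- An affine permutation preserving `cross` either preserves or swaps the two planes. -/
theorem planes_of_mem_affStab_cross {g : Perm Sixteen} (hg : g ∈ affStab cross) :
    ((∀ x : Sixteen, x.2 = 0 → (g x).2 = 0) ∧ ∀ x : Sixteen, x.1 = 0 → (g x).1 = 0) ∨
      ((∀ x : Sixteen, x.2 = 0 → (g x).1 = 0) ∧ ∀ x : Sixteen, x.1 = 0 → (g x).2 = 0) := by
  have hs := (mem_affStab.1 hg).2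
  have hadd := apply_add_of_mem_affStab_cross hg
  have hne := fun x hx => apply_ne_zero_of_mem_affStab_cross hg (x := x) hx
  have h1 : ∀ x ∈ cross, ∀ y ∈ cross, x ≠ 0 → x + y ∈ cross →
      ((g x).2 = 0 ∧ (g y).2 = 0) ∨ ((g x).1 = 0 ∧ (g y).1 = 0) := fun x hx y hy h0 hxy =>
    fst_or_snd_cross _ ((hs x).2 hx) _ ((hs y).2 hy) ⟨hne x h0, by rw [← hadd]; exact (hs _).2 hxy⟩
  have hfst : ∀ x : Sixteen, x.2 = 0 →
      ((g ((1, 0), 0)).2 = 0 ∧ (g x).2 = 0) ∨ ((g ((1, 0), 0)).1 = 0 ∧ (g x).1 = 0) :=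
    fun x hx => h1 _ (by decide) _ (Or.inr hx) (by decide) (Or.inr (by simp [hx]))
  have hsnd : ∀ x : Sixteen, x.1 = 0 →
      ((g (0, (1, 0))).2 = 0 ∧ (g x).2 = 0) ∨ ((g (0, (1, 0))).1 = 0 ∧ (g x).1 = 0) :=
    fun x hx => h1 _ (by decide) _ (Or.inl hx) (by decide) (Or.inl (by simp [hx]))
  have hu := hne ((1, 0), 0) (by decide)
  have hv := hne (0, (1, 0)) (by decide)
  have huv : ¬ g ((1, 0), 0) + g (0, (1, 0)) ∈ cross := by
    rw [← hadd, hs]; decide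
  generalize g ((1, 0), 0) = u at *
  generalize g (0, (1, 0)) = v at *
  have hkey : (u.1 ≠ 0 ∧ v.2 ≠ 0) ∨ (u.2 ≠ 0 ∧ v.1 ≠ 0) := by
    have hu' := hfst 0 rfl
    have hv' := hsnd 0 rfl
    have e1 : u.1 = 0 → u.2 = 0 → u = 0 := fun h h' => Prod.ext h h'
    have e2 : v.1 = 0 → v.2 = 0 → v = 0 := fun h h' => Prod.ext h h'
    have e3 : u.1 = 0 → v.1 = 0 → u + v ∈ cross := fun h h' => Or.inl (by simp [h, h'])
    have e4 : u.2 = 0 → v.2 = 0 → u + v ∈ cross := fun h h' => Or.inr (by simp [h, h'])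
    tauto
  rcases hkey with h | h
  · exact Or.inl ⟨fun x hx => by have := hfst x hx; tauto, fun x hx => by have := hsnd x hx; tauto⟩
  · exact Or.inr ⟨fun x hx => by have := hfst x hx; tauto, fun x hx => by have := hsnd x hx; tauto⟩

theorem isThreeTwo_affStab_cross : IsThreeTwo (affStab cross) := by
  let Y₁ : Set Sixteen := {x | x.2 = 0 ∧ x ≠ 0}
  let Y₂ : Set Sixteen := {x | x.1 = 0 ∧ x ≠ 0}
  let S : Subgroup (Perm Sixteen) := affStab cross ⊓ (setStab Y₁ ⊓ setStab Y₂)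
  have hY₁ : Nat.card Y₁ = 3 := by
    rw [Nat.card_coe_set_eq, Set.ncard_eq_toFinset_card']; decide
  have hY₂ : Nat.card Y₂ = 3 := by
    rw [Nat.card_coe_set_eq, Set.ncard_eq_toFinset_card']; decide
  have hS : IsThreeTwo S := by
    refine ((IsThreeTwo.perm_of_card_eq_three hY₁).prod
      (IsThreeTwo.perm_of_card_eq_three hY₂)).of_injective
      ((restrictHom S Y₁ fun g hg x hx => (mem_setStab.1 hg.2.1 x).2 hx).prod
        (restrictHom S Y₂ fun g hg x hx => (mem_setStab.1 hg.2.2 x).2 hx))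
      ((injective_iff_map_eq_one _).2 fun g hg => Subtype.ext ?_)
    refine aff_eq_one g.2.1.1 robustlySpans_cross.spans (x₀ := 0) (by decide) fun x hx => ?_
    by_cases h0 : x = 0
    · rw [h0]; exact apply_zero_of_mem_affStab_cross g.2.1
    rcases hx with hx | hx
    · exact congrArg Subtype.val (Equiv.congr_fun (congrArg Prod.snd hg) (⟨x, hx, h0⟩ : Y₂))
    · exact congrArg Subtype.val (Equiv.congr_fun (congrArg Prod.fst hg) (⟨x, hx, h0⟩ : Y₁))
  have hpres : ∀ g ∈ affStab cross, (∀ x : Sixteen, x.2 = 0 → (g x).2 = 0) →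
      (∀ x : Sixteen, x.1 = 0 → (g x).1 = 0) → g ∈ S := by
    intro g hg h1 h2
    have h0 := fun x hx => apply_ne_zero_of_mem_affStab_cross hg (x := x) hx
    have hfin : ∀ Y : Set Sixteen, (∀ x ∈ Y, g x ∈ Y) → g ∈ setStab Y := fun Y hY => by
      refine mem_setStab.2 fun x => ⟨fun hx => ?_, hY x⟩
      simpa using Perm.perm_symm_mapsTo_of_mapsTo g hY hx
    exact ⟨hg, hfin _ fun x hx => ⟨h1 x hx.1, h0 x hx.2⟩, hfin _ fun x hx => ⟨h2 x hx.1, h0 x hx.2⟩⟩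
  let e : S.subgroupOf (affStab cross) ≃* S := Subgroup.subgroupOfEquivOfLe inf_le_left
  refine IsThreeTwo.of_subgroup (S.subgroupOf (affStab cross)) (fun g => ⟨1, ?_⟩)
    (hS.of_injective e.toMonoidHom e.injective)
  rw [pow_one, pow_two, Subgroup.mem_subgroupOf]
  refine hpres _ (g * g).2 ?_ ?_
  · rcases planes_of_mem_affStab_cross g.2 with h | h
    · exact fun x hx => h.1 _ (h.1 x hx)
    · exact fun x hx => h.2 _ (h.1 x hx)
  · rcases planes_of_mem_affStab_cross g.2 with h | h
    · exact fun x hx => h.2 _ (h.2 x hx)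
    · exact fun x hx => h.1 _ (h.2 x hx)


set_option maxRecDepth 10000 in
theorem sum_crossPoint : ∑ x : Sixteen with x ∈ crossPoint, x = ((1, 0), (1, 0)) := by decide

theorem linearPart_of_mem_affStab_crossPoint {g : Perm Sixteen} (ha : g ∈ affPerm Sixteen)
    (hs : ∀ x, g x ∈ crossPoint ↔ x ∈ crossPoint) :
    linearPart ha ((1, 0), (1, 0)) = ((1, 0), (1, 0)) := by
  conv_lhs => rw [← sum_crossPoint]
  simp only [map_sum, linearPart_apply, Finset.sum_sub_distrib]
  have h1 : ∑ x : Sixteen with x ∈ crossPoint, g x = ((1, 0), (1, 0)) := by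
    rw [← sum_crossPoint]
    refine Finset.sum_nbij g (fun x => ?_) g.injective.injOn (fun x hx => ⟨g⁻¹ x, ?_, by simp⟩)
      fun _ _ => rfl
    · simp [hs]
    · have := hs (g⁻¹ x)
      rw [← Perm.mul_apply, mul_inv_cancel, Perm.one_apply] at this
      rw [Finset.coe_filter] at hx ⊢
      exact ⟨Finset.mem_univ _, this.1 hx.2⟩
  have h2 : ({x | x ∈ crossPoint} : Finset Sixteen).card = 8 := by decide
  have h3 : ∀ x : Sixteen, 8 • x = 0 := by decide
  rw [h1, Finset.sum_const, h2, h3, sub_zero]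

/-- The points of `crossPoint` which remain in it when translated by the exceptional point. -/
def rectangle : Set Sixteen :=
  {x | x = 0 ∨ x = ((1, 0), (1, 0)) ∨ x = ((1, 0), 0) ∨ x = (0, (1, 0))}

instance : DecidablePred (· ∈ rectangle) := fun x =>
  inferInstanceAs (Decidable (x = 0 ∨ x = ((1, 0), (1, 0)) ∨ x = ((1, 0), 0) ∨ x = (0, (1, 0))))

theorem mem_rectangle : ∀ x : Sixteen, x ∈ crossPoint →
    x + ((1, 0), (1, 0)) ∈ crossPoint →
      x ∈ rectangle := by
  decide

set_option maxRecDepth 10000 in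
theorem rectangle_add : ∀ x : Sixteen,
    x ∈ rectangle →
      x ∈ crossPoint ∧ x + ((1, 0), (1, 0)) ∈ crossPoint := by
  decide

set_option maxRecDepth 10000 in
set_option synthInstance.maxSize 1000 in
theorem rectangle_pair : ∀ x : Sixteen, x ∈ rectangle → ∀ y : Sixteen, y ∈ rectangle →
    y ≠ x ∧ y ≠ x + ((1, 0), (1, 0)) → ∀ z : Sixteen, z ∈ rectangle →
      z ≠ y ∧ z ≠ y + ((1, 0), (1, 0)) → z = x ∨ z = x + ((1, 0), (1, 0)) := by
  decide

set_option maxRecDepth 10000 in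
theorem crossPoint_add_fst : ∀ x : Sixteen, x ∈ crossPoint → x + ((1, 0), 0) ∈ crossPoint →
    x ∉ rectangle →
      x = ((0, 1), 0) ∨ x = ((1, 1), 0) := by
  decide

set_option maxRecDepth 10000 in
theorem crossPoint_add_snd : ∀ x : Sixteen, x ∈ crossPoint → x + (0, (1, 0)) ∈ crossPoint →
    x ∉ rectangle →
      x = (0, (0, 1)) ∨ x = (0, (1, 1)) := by
  decide

theorem isPGroup_affStab_crossPoint : IsPGroup 2 (affStab crossPoint) := by
  refine isPGroup_affStab fun g m hm hg ha hs => ?_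
  have hL := linearPart_of_mem_affStab_crossPoint ha hs
  have hgs : ∀ x, g (x + ((1, 0), (1, 0))) = g x + ((1, 0), (1, 0)) := fun x => by
    rw [aff_add ha, hL]
  have hss : ∀ x : Sixteen, x + ((1, 0), (1, 0)) + ((1, 0), (1, 0)) = x := by decide
  have hR : ∀ x : Sixteen,
      x ∈ rectangle →
      g x ∈ rectangle :=
    fun x hx => mem_rectangle _ ((hs x).2 (rectangle_add x hx).1)
      (by rw [← hgs]; exact (hs _).2 (rectangle_add x hx).2)
  have h2 : ∀ x : Sixteen,
      x ∈ rectangle →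
      (g (g x) = x ∨ g (g x) = x + ((1, 0), (1, 0))) := by
    intro x hx
    by_cases h : g x = x ∨ g x = x + ((1, 0), (1, 0))
    · rcases h with h | h
      · rw [h, h]; exact Or.inl rfl
      · rw [h, hgs, h, hss]; exact Or.inl rfl
    · rw [not_or] at h
      refine rectangle_pair x hx (g x) (hR x hx) h _ (hR _ (hR x hx)) ?_
      rw [← hgs]
      exact h.imp (fun h => g.injective.ne h) (fun h => g.injective.ne h)
  have h4 : ∀ x : Sixteen,
      x ∈ rectangle → g x = x := by
    intro x hx
    refine apply_eq_of_odd (k := 2) hm hg ?_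
    change g (g (g (g x))) = x
    rcases h2 x hx with h | h
    · rw [h, h]
    · rw [h, hgs, hgs, h, hss]
  have h0 : g 0 = 0 := h4 0 (by decide)
  have hadd : ∀ x y, g (x + y) = g x + g y := fun x y => by
    rw [aff_add ha, linearPart_apply, h0, sub_zero]
  have hne : ∀ x : Sixteen,
      x ∉ rectangle →
      g x ∉ rectangle :=
    fun x hx h => hx (by rwa [g.injective (h4 _ h)] at h)
  have hfst : ∀ x : Sixteen, x = ((0, 1), 0) ∨ x = ((1, 1), 0) →
      g x = ((0, 1), 0) ∨ g x = ((1, 1), 0) := by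
    intro x hx
    refine crossPoint_add_fst _ ((hs x).2 ?_) ?_ (hne x ?_)
    · rcases hx with rfl | rfl <;> decide
    · rw [show g x + ((1, 0), 0) = g (x + ((1, 0), 0)) by
        rw [hadd, h4 ((1, 0), 0) (by decide)], hs]
      rcases hx with rfl | rfl <;> decide
    · rcases hx with rfl | rfl <;> decide
  have hsnd : ∀ x : Sixteen, x = (0, (0, 1)) ∨ x = (0, (1, 1)) →
      g x = (0, (0, 1)) ∨ g x = (0, (1, 1)) := by
    intro x hx
    refine crossPoint_add_snd _ ((hs x).2 ?_) ?_ (hne x ?_)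
    · rcases hx with rfl | rfl <;> decide
    · rw [show g x + (0, (1, 0)) = g (x + (0, (1, 0))) by
        rw [hadd, h4 (0, (1, 0)) (by decide)], hs]
      rcases hx with rfl | rfl <;> decide
    · rcases hx with rfl | rfl <;> decide
  have hb : g ((0, 1), 0) = ((0, 1), 0) :=
    apply_eq_of_mem_pair hm hg (hfst _ (Or.inl rfl)) (hfst _ (Or.inr rfl))
  have hd : g (0, (0, 1)) = (0, (0, 1)) :=
    apply_eq_of_mem_pair hm hg (hsnd _ (Or.inl rfl)) (hsnd _ (Or.inr rfl))
  have ha' : g ((1, 0), 0) = ((1, 0), 0) := h4 _ (by decide)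
  have hf : g (0, (1, 0)) = (0, (1, 0)) := h4 _ (by decide)
  have hspan : ∀ x : Sixteen, x = x.1.1.val • ((1, 0), 0) + x.1.2.val • ((0, 1), 0) +
      (x.2.1.val • (0, (1, 0)) + x.2.2.val • (0, (0, 1))) := by
    decide
  have hsmul : ∀ (n : ℕ) (x : Sixteen), g (n • x) = n • g x := fun n x => by
    have := map_nsmul (linearPart ha) n x
    rwa [linearPart_apply, linearPart_apply, h0, sub_zero, sub_zero] at this
  apply Equiv.ext
  intro x
  rw [Perm.one_apply]
  conv_lhs => rw [hspan x]
  simp only [hadd, hsmul, hb, hd, ha', hf]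
  exact (hspan x).symm

theorem hasSeed_two : HasSeed 2 Sixteen := by
  have hc : Nat.card Sixteen = 16 := by simp
  have h1 : crossPoint.ncard = 8 := by
    rw [Set.ncard_eq_toFinset_card']; decide
  have h2 : cross.ncard = 7 := by
    rw [Set.ncard_eq_toFinset_card']; decide
  refine ⟨crossPoint, cross, isPGroup_affStab_crossPoint, isThreeTwo_affStab_cross,
    robustlySpans_crossPoint, robustlySpans_cross, by omega, by omega, by omega,
    by omega, by omega, by omega, by omega⟩

end Two

theorem two_nsmul_sixteen : ∀ w : Sixteen, 2 • w = 0 := by decide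

theorem three_nsmul_zmod_prod : ∀ w : ZMod 3 × ZMod 3, 3 • w = 0 := by decide

/-- Every large enough elementary abelian group has a seed. -/
theorem hasSeed_or_card {p : ℕ} (hp : p.Prime) {W : Type*} [AddCommGroup W] [Finite W]
    (hW : ∀ w : W, p • w = 0) :
    HasSeed p W ∨ Nat.card W ≤ 4 ∨ (p = 2 ∧ Nat.card W = 8) := by
  have := Fact.mk hp
  obtain ⟨d, hd⟩ : ∃ d, Nat.card W = p ^ d := by
    let _ : Module (ZMod p) W := AddCommGroup.zmodModule hW
    exact ⟨_, (FiniteField.pow_finrank_eq_natCard p W).symm⟩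
  rcases Nat.eq_zero_or_pos d with rfl | hd0
  · right; left; rw [hd]; norm_num
  by_cases h5 : 5 ≤ p
  · refine Or.inl (HasSeed.of_le hp one_pos (fun W _ hW hc => ?_) hd0 W hW hd)
    have : Finite W := Nat.finite_of_card_ne_zero (by rw [hc]; exact pow_ne_zero _ hp.ne_zero)
    obtain ⟨e⟩ := exists_addEquiv_of_card_eq (W := W) (W' := ZMod p) hp hW (by simp)
      (by rw [hc]; simp)
    exact (hasSeed_zmod h5).of_addEquiv e
  have h2 := hp.two_le
  obtain rfl | rfl : p = 2 ∨ p = 3 := by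
    have : p ≠ 4 := by rintro rfl; revert hp; decide
    omega
  · by_cases h4 : 4 ≤ d
    · refine Or.inl (HasSeed.of_le hp (d₀ := 4) (by norm_num) (fun W _ hW hc => ?_) h4 W hW hd)
      have : Finite W := Nat.finite_of_card_ne_zero (by rw [hc]; norm_num)
      obtain ⟨e⟩ := exists_addEquiv_of_card_eq (W := W) (W' := Sixteen) hp hW two_nsmul_sixteen
        (by rw [hc]; simp)
      exact hasSeed_two.of_addEquiv e
    · right
      interval_cases d
      · left; omega
      · left; omega
      · right; omega
  · by_cases h4 : 2 ≤ d
    · refine Or.inl (HasSeed.of_le hp (d₀ := 2) (by norm_num) (fun W _ hW hc => ?_) h4 W hW hd)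
      have : Finite W := Nat.finite_of_card_ne_zero (by rw [hc]; norm_num)
      obtain ⟨e⟩ := exists_addEquiv_of_card_eq (W := W) (W' := ZMod 3 × ZMod 3) hp hW
        three_nsmul_zmod_prod
        (by rw [hc]; simp)
      exact hasSeed_three.of_addEquiv e
    · right; left
      have : d = 1 := by omega
      subst this
      omega

/-- The elementary abelian group of order 8. -/
abbrev Eight := ZMod 2 × ZMod 2 × ZMod 2

theorem exists_addEquiv_eight {W : Type*} [AddCommGroup W] (hW : ∀ w : W, 2 • w = 0)
    (hc : Nat.card W = 8) : Nonempty (W ≃+ Eight) := by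
  have : Finite W := Nat.finite_of_card_ne_zero (by omega)
  exact exists_addEquiv_of_card_eq Nat.prime_two hW (by decide) (by rw [hc]; simp)

theorem spans_eight {Δ : Set Eight} (x y z : Eight) (hx : x ∈ Δ) (hy : y ∈ Δ) (hz : z ∈ Δ)
    (h0 : 0 ∈ Δ) (h : ∀ v : Eight, ∃ l m n : ℕ, v = l • x + m • y + n • z) : Spans Δ := by
  intro K hK
  have h1 : ∀ v ∈ Δ, v ∈ K := fun v hv => by simpa using hK v hv 0 h0
  rw [eq_top_iff]
  intro v _
  obtain ⟨l, m, n, rfl⟩ := h v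
  exact K.add_mem (K.add_mem (K.nsmul_mem (h1 x hx) _) (K.nsmul_mem (h1 y hy) _))
    (K.nsmul_mem (h1 z hz) _)

theorem exists_nsmul_eight (v : Eight) :
    ∃ l m n : ℕ, v = l • ((1, 0, 0) : Eight) + m • (0, 1, 0) + n • (0, 0, 1) :=
  ⟨v.1.val, v.2.1.val, v.2.2.val, by simp⟩

section TwoColouring

/-- A colouring, with colour classes not all of the same size, whose affine stabilizer is a
2-group. -/
theorem exists_colouring_isPGroup {p : ℕ} (hp : p.Prime) {W : Type*} [AddCommGroup W] [Finite W]
    (hW : ∀ w : W, p • w = 0) :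
    ∃ c : W → Fin 3, IsPGroup 2 ↥(affPerm W ⊓ colorStab c) ∧
      ∃ i j, (c ⁻¹' {i}).ncard ≠ (c ⁻¹' {j}).ncard := by
  rcases hasSeed_or_card hp hW with h | h | ⟨rfl, h⟩
  · obtain ⟨Δ, -, h1, -, -, -, h2, -⟩ := h
    classical
    refine ⟨fun x => if x ∈ Δ then 0 else 1, ?_, 0, 2, ?_⟩
    · refine h1.to_le (inf_le_inf_left _ fun g hg => mem_setStab.2 fun x => ?_)
      have := hg x
      by_cases h3 : g x ∈ Δ <;> by_cases h4 : x ∈ Δ <;> simp_all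
    · have e1 : ((fun x => if x ∈ Δ then 0 else 1 : W → Fin 3) ⁻¹' {0}) = Δ := by
        ext x; by_cases h : x ∈ Δ <;> simp [h]
      have e2 : ((fun x => if x ∈ Δ then 0 else 1 : W → Fin 3) ⁻¹' {2}) = ∅ := by
        ext x; by_cases h : x ∈ Δ <;> simp [h]
      rw [e1, e2, Set.ncard_empty]
      omega
  · let e : W ≃ Fin (Nat.card W) := Finite.equivFin W
    let f : Fin 4 → Fin 3 := ![0, 0, 1, 2]
    refine ⟨fun x => f (Fin.castLE h (e x)), ?_, 0, 2, ?_⟩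
    · refine isPGroup_two_of_odd fun g m hm hg => Subtype.ext (Equiv.ext fun x => ?_)
      have hf : ∀ i j k : Fin 4, f i = f j → f i = f k → i = j ∨ j = k ∨ i = k := by decide
      have hinj : ∀ x y, Fin.castLE h (e x) = Fin.castLE h (e y) → x = y := fun x y hxy =>
        e.injective (Fin.castLE_injective h hxy)
      have hc := g.2.2
      have h2 := hc ((g : Perm W) x)
      rw [hc x] at h2
      have hg' : (g : Perm W) ^ m = 1 := congrArg Subtype.val hg
      change (g : Perm W) x = x
      rcases hf _ _ _ (hc x).symm h2.symm with h | h | h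
      · exact (hinj _ _ h).symm
      · exact ((g : Perm W).injective (hinj _ _ h)).symm
      · exact apply_eq_of_odd (k := 1) hm hg' (hinj _ _ h).symm
    · have hpos : 0 < Nat.card W := Nat.card_pos
      have hcount : ∀ n, 0 < n → ∀ h : n ≤ 4,
          (Finset.univ.filter fun x : Fin n => f (Fin.castLE h x) = 0).card ≠
          (Finset.univ.filter fun x : Fin n => f (Fin.castLE h x) = 2).card := by
        intro n hn h
        interval_cases n <;> (revert h; decide)
      have hcard : ∀ i, ((fun x => f (Fin.castLE h (e x))) ⁻¹' {i}).ncard =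
          (Finset.univ.filter fun x => f (Fin.castLE h x) = i).card := fun i => by
        rw [← Set.ncard_coe_finset, ← Set.ncard_preimage_of_injective_subset_range e.injective
          (by simp [e.surjective.range_eq])]
        congr 1; ext x; simp
      rw [hcard, hcard]
      exact hcount _ hpos h
  · obtain ⟨e⟩ := exists_addEquiv_eight hW h
    let f : Eight → Fin 3 := fun x => if x = 0 ∨ x = (1, 0, 0) then 0 else
      if x = (0, 1, 0) ∨ x = (0, 0, 1) then 1 else 2
    refine ⟨f ∘ e, ?_, 0, 2, ?_⟩
    · refine isPGroup_two_of_odd fun g m hm hg => Subtype.ext ?_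
      have hg' : (g : Perm W) ^ m = 1 := congrArg Subtype.val hg
      have hc := g.2.2
      have hf0 : ∀ x, f x = 0 → x = 0 ∨ x = (1, 0, 0) := by decide
      have hf1 : ∀ x, f x = 1 → x = (0, 1, 0) ∨ x = (0, 0, 1) := by decide
      have hpt : ∀ u v : Eight, f u = f v → (∀ x, f x = f u → x = u ∨ x = v) →
          (g : Perm W) (e.symm u) = e.symm u := by
        intro u v huv hx
        have key : ∀ w, f w = f u →
            (g : Perm W) (e.symm w) = e.symm u ∨ (g : Perm W) (e.symm w) = e.symm v := by
          intro w hw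
          have h1 := hc (e.symm w)
          simp only [Function.comp_apply, AddEquiv.apply_symm_apply, hw] at h1
          exact (hx _ h1).imp (fun h => by rw [← h]; simp) fun h => by rw [← h]; simp
        exact apply_eq_of_mem_pair hm hg' (key u rfl) (key v huv.symm)
      have hs : Spans (e ⁻¹' {0, (1, 0, 0), (0, 1, 0), (0, 0, 1)}) :=
        (spans_eight (1, 0, 0) (0, 1, 0) (0, 0, 1) (by simp) (by simp) (by simp) (by simp)
          exists_nsmul_eight).preimage e
      refine aff_eq_one g.2.1 hs (x₀ := 0) (by simp) fun x hx => ?_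
      rw [← e.symm_apply_apply x]
      rcases hx with hx | hx | hx | hx <;> rw [hx]
      · exact hpt 0 (1, 0, 0) (by decide) (by decide)
      · exact hpt (1, 0, 0) 0 (by decide) (by decide)
      · exact hpt (0, 1, 0) (0, 0, 1) (by decide) (by decide)
      · exact hpt (0, 0, 1) (0, 1, 0) (by decide) (by decide)
    · rw [Set.preimage_comp, Set.preimage_comp,
        Set.ncard_preimage_of_injective_subset_range e.injective (by simp [e.surjective.range_eq]),
        Set.ncard_preimage_of_injective_subset_range e.injective (by simp [e.surjective.range_eq]),
        show f ⁻¹' {0} = (Finset.univ.filter fun x => f x = 0 : Finset Eight) by ext; simp,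
        show f ⁻¹' {2} = (Finset.univ.filter fun x => f x = 2 : Finset Eight) by ext; simp,
        Set.ncard_coe_finset, Set.ncard_coe_finset]
      decide

end TwoColouring

theorem exists_three_colourings {p : ℕ} (hp : p.Prime) {W : Type*} [AddCommGroup W] [Finite W]
    (hW : ∀ w : W, p • w = 0) :
    ∃ d : Fin 3 → W → Fin 3, (∀ i, IsPGroup 2 ↥(affPerm W ⊓ colorStab (d i))) ∧
      ∀ i j (g : Perm W), (∀ x, d i (g x) = d j x) → i = j := by
  obtain ⟨c, hc, k, l, hkl⟩ := exists_colouring_isPGroup hp hW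
  refine ⟨fun i x => c x + i, fun i => hc.to_le (inf_le_inf_left _ fun g hg x => ?_),
    fun i j g h => ?_⟩
  · simpa using hg x
  · have hcard : ∀ m, (c ⁻¹' {m}).ncard = (c ⁻¹' {m + (j - i)}).ncard := by
      intro m
      have : c ⁻¹' {m} = g ⁻¹' (c ⁻¹' {m + (j - i)}) := by
        ext x
        simp only [Set.mem_preimage, Set.mem_singleton_iff]
        have hx : c (g x) + i = c x + j := h x
        rw [eq_sub_of_add_eq hx, ← add_sub_assoc, sub_left_inj, add_left_inj]
      rw [this, Set.ncard_preimage_of_injective_subset_range g.injective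
        (by simp [g.surjective.range_eq])]
    by_contra hij
    have key : ∀ i j k l : Fin 3, i ≠ j → l = k ∨ l = k + (j - i) ∨ l = k + (j - i) + (j - i) := by
      decide
    rcases key i j k l hij with rfl | rfl | rfl
    · exact hkl rfl
    · exact hkl (hcard _)
    · exact hkl ((hcard _).trans (hcard _))

/-- A permutation group which is faithful on four points and does not induce a given double
transposition there. -/
theorem IsThreeTwo.of_restrict_four {X : Type*} (S : Subgroup (Perm X)) (y : Fin 4 → X)
    (hy : Function.Injective y) (hpres : ∀ g ∈ S, ∀ i, ∃ j, g (y i) = y j)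
    (hfaith : ∀ g ∈ S, (∀ i, g (y i) = y i) → g = 1)
    (h : ∀ g ∈ S, ¬ (g (y 0) = y 1 ∧ g (y 1) = y 0 ∧ g (y 2) = y 3 ∧ g (y 3) = y 2)) :
    IsThreeTwo S := by
  let f := restrictHom S (Set.range y) fun g hg x hx => by
    obtain ⟨i, rfl⟩ := hx
    obtain ⟨j, hj⟩ := hpres g hg i
    exact ⟨j, hj.symm⟩
  have hf : Function.Injective f := (injective_iff_map_eq_one _).2 fun g hg =>
    Subtype.ext (hfaith g g.2 fun i =>
      congrArg Subtype.val (Equiv.congr_fun hg (⟨y i, i, rfl⟩ : Set.range y)))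
  refine (IsThreeTwo.of_forall_ne (Equiv.ofInjective y hy) f.range ?_).of_injective
    f.rangeRestrict (MonoidHom.rangeRestrict_injective_iff.2 hf)
  rintro _ ⟨g, rfl⟩ ⟨h0, h1, h2, h3⟩
  exact h g g.2 ⟨congrArg Subtype.val h0, congrArg Subtype.val h1, congrArg Subtype.val h2,
    congrArg Subtype.val h3⟩

theorem aff_ext {W : Type*} [AddCommGroup W] {g h : Perm W} (hg : g ∈ affPerm W)
    (hh : h ∈ affPerm W) {Δ : Set W} (hΔ : Spans Δ) {x₀ : W} (hx₀ : x₀ ∈ Δ)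
    (hgh : ∀ x ∈ Δ, g x = h x) : g = h := by
  have := aff_eq_one ((affPerm W).mul_mem ((affPerm W).inv_mem hh) hg) hΔ hx₀ fun x hx => by
    rw [Perm.mul_apply, hgh x hx, ← Perm.mul_apply, inv_mul_cancel, Perm.one_apply]
  exact (inv_mul_eq_one.1 this).symm

section Eight

/-- A transvection. -/
def transvection : Perm Eight where
  toFun x := (x.1 + x.2.2, x.2.1, x.2.2)
  invFun x := (x.1 + x.2.2, x.2.1, x.2.2)
  left_inv := by unfold Function.LeftInverse; decide
  right_inv := by unfold Function.RightInverse Function.LeftInverse; decide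

theorem transvection_mem : transvection ∈ affPerm Eight := by
  intro x y z
  ext <;> simp [transvection]; ring

/-- Exchange of the last two coordinates. -/
def exchangeLast : Eight ≃+ Eight where
  toFun x := (x.1, x.2.2, x.2.1)
  invFun x := (x.1, x.2.2, x.2.1)
  left_inv _ := rfl
  right_inv _ := rfl
  map_add' _ _ := rfl

/-- Exchange of the first two coordinates. -/
def exchangeFirst : Eight ≃+ Eight where
  toFun x := (x.2.1, x.1, x.2.2)
  invFun x := (x.2.1, x.1, x.2.2)
  left_inv _ := rfl
  right_inv _ := rfl
  map_add' _ _ := rfl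

/-- The transvection in the coordinates `e`. -/
def transvectionOf {W : Type*} [AddCommGroup W] (e : W ≃+ Eight) : Perm W :=
  e.toEquiv.symm.permCongr transvection

set_option maxRecDepth 10000 in
theorem transvection_eq_commutator :
    transvection = ⁅transvectionOf exchangeLast, transvectionOf exchangeFirst⁆ := by
  rw [commutatorElement_def, eq_mul_inv_iff_mul_eq, eq_mul_inv_iff_mul_eq]
  have key : ∀ x : Eight, (transvection * transvectionOf exchangeFirst *
      transvectionOf exchangeLast) x =
      (transvectionOf exchangeLast * transvectionOf exchangeFirst) x := by decide
  exact Equiv.ext key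

theorem transvectionOf_eq_commutator {W : Type*} [AddCommGroup W] (e : W ≃+ Eight) :
    transvectionOf e = ⁅transvectionOf (e.trans exchangeLast),
      transvectionOf (e.trans exchangeFirst)⁆ := by
  have h := congrArg e.toEquiv.symm.permCongrHom transvection_eq_commutator
  rw [map_commutatorElement] at h
  exact h

/-- A solvable group does not contain all transvections. -/
theorem exists_transvectionOf_notMem {W : Type*} [AddCommGroup W] (e : W ≃+ Eight)
    (H : Subgroup (Perm W)) [Group.IsSolvable H] : ∃ e : W ≃+ Eight, transvectionOf e ∉ H := by
  by_contra! hc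
  have key : ∀ n (e : W ≃+ Eight), transvectionOf e ∈ (derivedSeries H n).map H.subtype := by
    intro n
    induction n with
    | zero =>
      intro e
      exact ⟨⟨_, hc e⟩, Subgroup.mem_top _, rfl⟩
    | succ n ih =>
      intro e
      rw [transvectionOf_eq_commutator, derivedSeries_succ, Subgroup.map_commutator]
      exact Subgroup.commutator_mem_commutator (ih _) (ih _)
  obtain ⟨n, hn⟩ := Group.IsSolvable.solvable (G := H)
  have h1 := key n e
  rw [hn, Subgroup.map_bot, Subgroup.mem_bot] at h1
  have h2 := congrArg e (Equiv.congr_fun h1 (e.symm (0, 0, 1)))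
  simp [transvectionOf, transvection] at h2

end Eight

theorem nsmul_spans_eight (v : Eight) : ∃ l m n : ℕ,
    v = l • ((0, 0, 1) : Eight) + m • ((1, 0, 1) : Eight) + n • ((0, 1, 1) : Eight) := by
  refine ⟨(v.2.2 + v.1 + v.2.1).val, v.1.val, v.2.1.val, ?_⟩
  revert v
  decide

theorem nsmul_spans_eight' (v : Eight) : ∃ l m n : ℕ,
    v = l • ((0, 1, 0) : Eight) + m • ((0, 0, 1) : Eight) + n • ((1, 1, 1) : Eight) := by
  refine ⟨(v.2.1 + v.1).val, (v.2.2 + v.1).val, v.1.val, ?_⟩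
  revert v
  decide

/-- The nonzero points of a plane. -/
def planeMinusPoint : Set Eight := {x | x.2.2 = 0 ∧ x ≠ 0}

/-- The origin together with a basis. -/
def simplexSet : Set Eight := {x | x = 0 ∨ x = (0, 1, 0) ∨ x = (0, 0, 1) ∨ x = (1, 1, 1)}

theorem isThreeTwo_planeMinusPoint (H : Subgroup (Perm Eight)) (hH : H ≤ affPerm Eight)
    (hT : transvection ∉ H) : IsThreeTwo ↥(H ⊓ setStab planeMinusPoint) := by
  have hplane : ∀ g ∈ H ⊓ setStab planeMinusPoint, (g 0).2.2 = 0 ∧ g 0 = 0 := by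
    rintro g ⟨hg, hs⟩
    replace hs := mem_setStab.1 hs
    have h0 : (g 0).2.2 = 0 := by
      have h1 := hH hg (1, 0, 0) (0, 1, 0) (1, 1, 0)
      have h2 := ((hs (1, 0, 0)).2 ⟨rfl, by decide⟩).1
      have h3 := ((hs (0, 1, 0)).2 ⟨rfl, by decide⟩).1
      have h4 := ((hs (1, 1, 0)).2 ⟨rfl, by decide⟩).1
      have h5 : ((1, 0, 0) - (0, 1, 0) + (1, 1, 0) : Eight) = 0 := by decide
      rw [h5] at h1
      rw [h1]
      simp [h2, h3, h4]
    refine ⟨h0, ?_⟩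
    by_contra hc
    exact ((hs 0).1 ⟨h0, hc⟩).2 rfl
  have hfix : ∀ g ∈ H ⊓ setStab planeMinusPoint, ∀ h ∈ affPerm Eight, h 0 = 0 →
      (∀ i : Fin 4, g ((![(0, 0, 1), (1, 0, 1), (0, 1, 1), (1, 1, 1)] : Fin 4 → Eight) i) =
      h ((![(0, 0, 1), (1, 0, 1), (0, 1, 1), (1, 1, 1)] : Fin 4 → Eight) i)) → g = h := by
    intro g hg h hh h0 hgh
    refine aff_ext (hH hg.1) hh (Δ := {0, (0, 0, 1), (1, 0, 1), (0, 1, 1)})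
      (spans_eight (0, 0, 1) (1, 0, 1) (0, 1, 1) (by simp) (by simp) (by simp) (by simp)
        nsmul_spans_eight) (x₀ := 0) (by simp) ?_
    rintro x (rfl | rfl | rfl | rfl)
    · rw [(hplane g hg).2, h0]
    · exact hgh 0
    · exact hgh 1
    · exact hgh 2
  refine IsThreeTwo.of_restrict_four _ ![(0, 0, 1), (1, 0, 1), (0, 1, 1), (1, 1, 1)]
    (by decide) (fun g hg i => ?_) (fun g hg h => hfix g hg 1 (one_mem _) rfl h)
    fun g hg ⟨h0, h1, h2, h3⟩ => hT ?_
  · have hy : ∀ z : Eight, z.2.2 ≠ 0 → ∃ j, z =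
        (![(0, 0, 1), (1, 0, 1), (0, 1, 1), (1, 1, 1)] : Fin 4 → Eight) j := by decide
    have hy' : ∀ i, ((![(0, 0, 1), (1, 0, 1), (0, 1, 1), (1, 1, 1)] : Fin 4 → Eight) i).2.2 ≠ 0 :=
      by decide
    refine hy _ fun hc => hy' i ?_
    by_cases hz : g ((![(0, 0, 1), (1, 0, 1), (0, 1, 1), (1, 1, 1)] : Fin 4 → Eight) i) = 0
    · rw [← (hplane g hg).2, g.injective.eq_iff] at hz
      rw [hz]; rfl
    · exact ((mem_setStab.1 hg.2 _).1 ⟨hc, hz⟩).1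
  · rw [← hfix g hg transvection transvection_mem rfl ?_]
    · exact hg.1
    · intro i
      fin_cases i
      · exact h0
      · exact h1
      · exact h2
      · exact h3

theorem isThreeTwo_simplexSet (H : Subgroup (Perm Eight)) (hH : H ≤ affPerm Eight)
    (htr : ∀ w, Equiv.addRight w ∈ H)
    (hT : transvection ∉ H) : IsThreeTwo ↥(H ⊓ setStab simplexSet) := by
  have hfix : ∀ g ∈ H ⊓ setStab simplexSet, ∀ h ∈ affPerm Eight,
      (∀ i : Fin 4, g ((![0, (0, 1, 0), (0, 0, 1), (1, 1, 1)] : Fin 4 → Eight) i) =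
      h ((![0, (0, 1, 0), (0, 0, 1), (1, 1, 1)] : Fin 4 → Eight) i)) → g = h := by
    intro g hg h hh hgh
    refine aff_ext (hH hg.1) hh (Δ := {0, (0, 1, 0), (0, 0, 1), (1, 1, 1)})
      (spans_eight (0, 1, 0) (0, 0, 1) (1, 1, 1) (by simp) (by simp) (by simp) (by simp)
        nsmul_spans_eight') (x₀ := 0) (by simp) ?_
    rintro x (rfl | rfl | rfl | rfl)
    · exact hgh 0
    · exact hgh 1
    · exact hgh 2
    · exact hgh 3
  refine IsThreeTwo.of_restrict_four _ ![0, (0, 1, 0), (0, 0, 1), (1, 1, 1)]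
    (by decide) (fun g hg i => ?_) (fun g hg h => hfix g hg 1 (one_mem _) h)
    fun g hg ⟨h0, h1, h2, h3⟩ => hT ?_
  · have hmem : (![0, (0, 1, 0), (0, 0, 1), (1, 1, 1)] : Fin 4 → Eight) i ∈ simplexSet := by
      fin_cases i <;> simp [simplexSet]
    rcases (mem_setStab.1 hg.2 _).2 hmem with h | h | h | h
    exacts [⟨0, h⟩, ⟨1, h⟩, ⟨2, h⟩, ⟨3, h⟩]
  · have h : g = Equiv.addRight ((0, 1, 0) : Eight) * transvection := by
      refine hfix g hg _ (mul_mem (hH (htr _)) transvection_mem) fun i => ?_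
      fin_cases i
      · exact h0
      · exact h1
      · exact h2
      · exact h3
    rw [← inv_mul_eq_iff_eq_mul] at h
    rw [← h]
    exact mul_mem (inv_mem (htr _)) hg.1

theorem exists_injective_inf_setStab {X Y : Type*} (e : X ≃ Y) (H : Subgroup (Perm X))
    (Δ : Set Y) : ∃ f : ↥(H ⊓ setStab (e ⁻¹' Δ)) →*
      ↥(H.map e.permCongrHom.toMonoidHom ⊓ setStab Δ), Function.Injective f := by
  refine ⟨((e.permCongrHom.toMonoidHom).comp (Subgroup.subtype _)).codRestrict _
    fun g => ⟨⟨g, g.2.1, rfl⟩, mem_setStab.2 fun x => ?_⟩, fun a b hab => ?_⟩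
  · simpa using mem_setStab.1 g.2.2 (e.symm x)
  · exact Subtype.ext (e.permCongrHom.injective (congrArg Subtype.val hab))

/-- A solvable affine group containing the translations has three set stabilizers of the required
shape, for sets of different sizes. -/
theorem exists_three_sets {p : ℕ} (hp : p.Prime) {W : Type*} [AddCommGroup W] [Finite W]
    [Nontrivial W] (hW : ∀ w : W, p • w = 0) (H : Subgroup (Perm W)) [Group.IsSolvable H]
    (hH : H ≤ affPerm W) (htr : ∀ w, Equiv.addRight w ∈ H) :
    ∃ Δ : Fin 3 → Set W, (∀ i, IsThreeTwo ↥(H ⊓ setStab (Δ i))) ∧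
      Function.Injective fun i => (Δ i).ncard := by
  suffices ∃ Δ₁ Δ₂ : Set W, IsThreeTwo ↥(H ⊓ setStab Δ₁) ∧ IsThreeTwo ↥(H ⊓ setStab Δ₂) ∧
      Δ₁.ncard ≠ Δ₂.ncard ∧ Δ₁.ncard + Δ₂.ncard ≠ Nat.card W ∧ 2 * Δ₂.ncard ≠ Nat.card W by
    obtain ⟨Δ₁, Δ₂, h1, h2, h3, h4, h5⟩ := this
    refine ⟨![Δ₁, Δ₂, Δ₂ᶜ], fun i => ?_, fun i j hij => ?_⟩
    · fin_cases i
      · exact h1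
      · exact h2
      · change IsThreeTwo ↥(H ⊓ setStab Δ₂ᶜ)
        rwa [setStab_compl]
    · have := Set.ncard_add_ncard_compl Δ₂
      fin_cases i <;> fin_cases j <;> simp at hij ⊢ <;> omega
  rcases hasSeed_or_card hp hW with h | h | ⟨rfl, h⟩
  · obtain ⟨Δ₁, Δ₂, h1, h2, -, -, -, -, -, -, h3⟩ := h
    exact ⟨Δ₁, Δ₂, (h1.to_le (inf_le_inf_right _ hH)).isThreeTwo,
      h2.of_injective (Subgroup.inclusion (inf_le_inf_right _ hH))
        (Subgroup.inclusion_injective _), h3⟩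
  · have h1 : 1 < Nat.card W := Finite.one_lt_card
    by_cases h4 : Nat.card W = 4
    · let e : Fin 4 ≃ W := (Finite.equivFinOfCardEq h4).symm
      refine ⟨{e 0, e 2}, {e 0}, IsThreeTwo.of_forall_ne e _ fun g hg hc => ?_,
        IsThreeTwo.of_forall_ne e _ fun g hg hc => ?_, ?_⟩
      · have := (mem_setStab.1 hg.2 (e 0)).2 (by simp)
        simp [hc.1] at this
      · have := (mem_setStab.1 hg.2 (e 0)).2 (by simp)
        simp [hc.1] at this
      · rw [Set.ncard_pair (by simp), Set.ncard_singleton]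
        omega
    · have hT : IsThreeTwo (Perm W) := by
        by_cases h3 : Nat.card W = 3
        · exact IsThreeTwo.perm_of_card_eq_three h3
        · have h2 : Nat.card W = 2 := by omega
          refine (IsPGroup.of_card (p := 2) (n := 1) ?_).isThreeTwo
          rw [Nat.card_perm, h2]
          rfl
      obtain ⟨x⟩ : Nonempty W := inferInstance
      refine ⟨{x}, ∅, hT.of_injective _ (Subgroup.subtype_injective _),
        hT.of_injective _ (Subgroup.subtype_injective _), ?_⟩
      rw [Set.ncard_singleton, Set.ncard_empty]
      omega
  · obtain ⟨e₀⟩ := exists_addEquiv_eight hW h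
    obtain ⟨e, he⟩ := exists_transvectionOf_notMem e₀ H
    have hH' : H.map e.toEquiv.permCongrHom.toMonoidHom ≤ affPerm Eight := by
      rintro _ ⟨g, hg, rfl⟩
      exact permCongr_mem_affPerm e (hH hg)
    have htr' : ∀ w, Equiv.addRight w ∈ H.map e.toEquiv.permCongrHom.toMonoidHom := fun w =>
      ⟨Equiv.addRight (e.symm w), htr _, by ext x <;> simp⟩
    have hT : transvection ∉ H.map e.toEquiv.permCongrHom.toMonoidHom := by
      rintro ⟨g, hg, hgt⟩
      refine he ?_
      rw [transvectionOf, ← hgt]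
      have : e.toEquiv.symm.permCongr (e.toEquiv.permCongrHom.toMonoidHom g) = g := by
        ext x
        simp
      rwa [this]
    have hcard : ∀ Δ : Set Eight, (e ⁻¹' Δ).ncard = Δ.ncard := fun Δ =>
      Set.ncard_preimage_of_injective_subset_range e.injective (by simp [e.surjective.range_eq])
    obtain ⟨f₁, hf₁⟩ := exists_injective_inf_setStab e.toEquiv H simplexSet
    obtain ⟨f₂, hf₂⟩ := exists_injective_inf_setStab e.toEquiv H planeMinusPoint
    refine ⟨e ⁻¹' simplexSet, e ⁻¹' planeMinusPoint,
      (isThreeTwo_simplexSet _ hH' htr' hT).of_injective f₁ hf₁,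
      (isThreeTwo_planeMinusPoint _ hH' hT).of_injective f₂ hf₂, ?_⟩
    have h4 : simplexSet.ncard = 4 := by
      rw [show simplexSet = {0, (0, 1, 0), (0, 0, 1), (1, 1, 1)} from rfl,
        Set.ncard_eq_toFinset_card']
      decide
    have h3 : planeMinusPoint.ncard = 3 := by
      have : planeMinusPoint = {(1, 0, 0), (0, 1, 0), (1, 1, 0)} := by
        have : ∀ x : Eight, (x.2.2 = 0 ∧ x ≠ 0) ↔
            (x = (1, 0, 0) ∨ x = (0, 1, 0) ∨ x = (1, 1, 0)) := by
          decide
        exact Set.ext this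
      rw [this, Set.ncard_eq_toFinset_card']
      decide
    rw [hcard, hcard, h4, h3, h]
    omega

section Predicates

variable {G Ω : Type*} [Group G] [MulAction G Ω]

/-- The elements of `U` act on the points of `X` as a 2-group. -/
def TwoOn (U : Set G) (X : Set Ω) : Prop := ∀ u ∈ U, ∀ x ∈ X, ∃ k : ℕ, u ^ 2 ^ k • x = x

/-- The elements of `U` act on the points of `X` as a group with `IsThreeTwo`. -/
def ThreeTwoOn (U : Set G) (X : Set Ω) : Prop :=
  (∀ u ∈ U, ∀ x ∈ X, ∃ k : ℕ, u ^ (3 * 2 ^ k) • x = x) ∧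
    ∀ u ∈ U, ∀ v ∈ U, (∀ x ∈ X, u ^ 3 • x = x) → (∀ x ∈ X, v ^ 3 • x = x) →
      ∀ x ∈ X, u • v • x = v • u • x

/-- A subgroup acting as an elementary abelian `p`-group. -/
structure ActsElementary (p : ℕ) (K : Subgroup G) (Ω : Type*) [MulAction G Ω] : Prop where
  comm : ∀ a ∈ K, ∀ b ∈ K, ∀ x : Ω, a • b • x = b • a • x
  pow : ∀ a ∈ K, ∀ x : Ω, a ^ p • x = x

end Predicates

section Local

universe u v
variable {p : ℕ} {T : Type u} [Group T] {X : Type v} [MulAction T X] {K : Subgroup T}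

/-- Coordinates on a set on which an elementary abelian group acts transitively. -/
theorem ActsElementary.exists_coordinates (hK : ActsElementary p K X) (x₀ : X)
    (htrans : ∀ x y : X, ∃ k ∈ K, k • x = y) :
    ∃ (W : Type v) (_ : AddCommGroup W) (e : X ≃ W), (∀ w : W, p • w = 0) ∧
      ∀ k ∈ K, ∃ w : W, ∀ x, e (k • x) = e x + w := by
  let R : Subgroup (Perm X) := K.map (MulAction.toPermHom T X)
  have hcomm : ∀ a b : R, a * b = b * a := by
    rintro ⟨_, a, ha, rfl⟩ ⟨_, b, hb, rfl⟩
    exact Subtype.ext (Equiv.ext (hK.comm a ha b hb))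
  have hpow : ∀ a : R, a ^ p = 1 := by
    rintro ⟨_, a, ha, rfl⟩
    refine Subtype.ext (Equiv.ext fun x => ?_)
    change ((MulAction.toPermHom T X a) ^ p) x = x
    rw [← map_pow]
    exact hK.pow a ha x
  let _ : CommGroup R := { mul_comm := hcomm }
  let f : R → X := fun r => (r : Perm X) x₀
  have hf : Function.Bijective f := by
    refine ⟨fun a b hab => Subtype.ext (Equiv.ext fun x => ?_), fun x => ?_⟩
    · obtain ⟨k, hk, rfl⟩ := htrans x₀ x
      have h : ∀ c : R, (c : Perm X) (k • x₀) = k • (c : Perm X) x₀ := fun c =>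
        Equiv.congr_fun (congrArg Subtype.val (hcomm c ⟨MulAction.toPermHom T X k, k, hk, rfl⟩)) x₀
      rw [h, h]
      exact congrArg _ hab
    · obtain ⟨k, hk, rfl⟩ := htrans x₀ x
      exact ⟨⟨_, k, hk, rfl⟩, rfl⟩
  refine ⟨Additive R, inferInstance, (Equiv.ofBijective f hf).symm.trans Additive.ofMul, hpow,
    fun k hk => ⟨Additive.ofMul ⟨MulAction.toPermHom T X k, k, hk, rfl⟩, fun x => ?_⟩⟩
  obtain ⟨r, rfl⟩ := hf.2 x
  have h1 : (Equiv.ofBijective f hf).symm (f r) = r := (Equiv.ofBijective f hf).symm_apply_apply r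
  have h2 : (Equiv.ofBijective f hf).symm (k • f r) =
      r * ⟨MulAction.toPermHom T X k, k, hk, rfl⟩ := by
    rw [Equiv.symm_apply_eq, hcomm]
    rfl
  rw [Equiv.trans_apply, Equiv.trans_apply, h1, h2]
  rfl

theorem permCongrHom_toPermHom_mem_affPerm [K.Normal] {W : Type v} [AddCommGroup W] (e : X ≃ W)
    (he : ∀ k ∈ K, ∃ w : W, ∀ x, e (k • x) = e x + w)
    (htrans : ∀ x y : X, ∃ k ∈ K, k • x = y) (u : T) :
    e.permCongrHom (MulAction.toPermHom T X u) ∈ affPerm W := by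
  intro x y z
  obtain ⟨k, hk, hkx⟩ := htrans (e.symm y) (e.symm x)
  obtain ⟨w, hw⟩ := he k hk
  obtain ⟨w', hw'⟩ := he (u * k * u⁻¹) (Subgroup.Normal.conj_mem inferInstance k hk u)
  have hx : x = y + w := by
    rw [← e.apply_symm_apply x, ← hkx, hw, e.apply_symm_apply]
  have hact : ∀ v : W, e (u • e.symm (v + w)) = e (u • e.symm v) + w' := fun v => by
    have h1 : e.symm (v + w) = k • e.symm v := by
      rw [Equiv.symm_apply_eq, hw, e.apply_symm_apply]
    rw [h1, ← hw', smul_smul, smul_smul, inv_mul_cancel_right]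
  have h1 : x - y + z = z + w := by rw [hx]; abel
  change e (u • e.symm _) = e (u • e.symm _) - e (u • e.symm _) + e (u • e.symm _)
  rw [h1, hact, hx, hact]
  abel

theorem ActsElementary.exists_three_colourings [Finite X] [K.Normal] (hp : p.Prime)
    (hK : ActsElementary p K X) (x₀ : X) (htrans : ∀ x y : X, ∃ k ∈ K, k • x = y) :
    ∃ d : Fin 3 → X → Fin 3, (∀ i, TwoOn {u : T | ∀ x, d i (u • x) = d i x} (Set.univ : Set X)) ∧
      ∀ i j (u : T), (∀ x, d i (u • x) = d j x) → i = j := by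
  obtain ⟨W, _, e, hW, he⟩ := hK.exists_coordinates x₀ htrans
  have : Finite W := Finite.of_equiv X e
  obtain ⟨d, hd, hij⟩ := SetStabilizer.exists_three_colourings hp hW
  let ρ : T →* Perm W := e.permCongrHom.toMonoidHom.comp (MulAction.toPermHom T X)
  have hρ : ∀ u w, ρ u w = e (u • e.symm w) := fun _ _ => rfl
  refine ⟨fun i x => d i (e x), fun i u hu x _ => ?_, fun i j u hu => ?_⟩
  · obtain ⟨k, hk⟩ := hd i ⟨ρ u, permCongrHom_toPermHom_mem_affPerm e he htrans u, fun w =>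
      (hu (e.symm w)).trans (congrArg (d i) (e.apply_symm_apply w))⟩
    have hk' : ρ u ^ 2 ^ k = 1 := congrArg Subtype.val hk
    refine ⟨k, e.injective ?_⟩
    have := hρ (u ^ 2 ^ k) (e x)
    rw [map_pow, hk', e.symm_apply_apply] at this
    exact this.symm
  · refine hij i j (ρ u) fun w => ?_
    exact (hu (e.symm w)).trans (congrArg (d j) (e.apply_symm_apply w))

theorem ActsElementary.exists_three_sets [Finite X] [Nontrivial X] [K.Normal]
    [Group.IsSolvable T] (hp : p.Prime)
    (hK : ActsElementary p K X) (x₀ : X) (htrans : ∀ x y : X, ∃ k ∈ K, k • x = y) :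
    ∃ d : Fin 3 → X → Prop,
      (∀ i, ThreeTwoOn {u : T | ∀ x, d i (u • x) = d i x} (Set.univ : Set X)) ∧
      ∀ i j (u : T), (∀ x, d i (u • x) = d j x) → i = j := by
  obtain ⟨W, _, e, hW, he⟩ := hK.exists_coordinates x₀ htrans
  have : Finite W := Finite.of_equiv X e
  have : Nontrivial W := e.symm.nontrivial
  let ρ : T →* Perm W := e.permCongrHom.toMonoidHom.comp (MulAction.toPermHom T X)
  have hρ : ∀ u w, ρ u w = e (u • e.symm w) := fun _ _ => rfl
  have hρ1 : ∀ u, ρ u = 1 ↔ ∀ x : X, u • x = x := fun u => by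
    refine ⟨fun h x => e.injective ?_, fun h => Equiv.ext fun w => ?_⟩
    · have := hρ u (e x)
      rw [h, e.symm_apply_apply] at this
      exact this.symm
    · rw [hρ, h, e.apply_symm_apply, Perm.one_apply]
  have : Group.IsSolvable ρ.range := Group.isSolvable_of_surjective ρ.rangeRestrict_surjective
  obtain ⟨Δ, hΔ, hinj⟩ := SetStabilizer.exists_three_sets hp hW ρ.range (by
    rintro _ ⟨u, rfl⟩
    exact permCongrHom_toPermHom_mem_affPerm e he htrans u) (fun w => by
    obtain ⟨k, hk, hkw⟩ := htrans (e.symm 0) (e.symm w)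
    obtain ⟨w', hw'⟩ := he k hk
    have hw : w = w' := by
      rw [← e.apply_symm_apply w, ← hkw, hw', e.apply_symm_apply, zero_add]
    refine ⟨k, Equiv.ext fun v => ?_⟩
    rw [hρ, hw', e.apply_symm_apply, hw]
    rfl)
  have hmem : ∀ i (u : T), (∀ x, (e (u • x) ∈ Δ i) = (e x ∈ Δ i)) →
      ρ u ∈ ρ.range ⊓ setStab (Δ i) := fun i u hu => ⟨⟨u, rfl⟩, mem_setStab.2 fun w => by
    rw [hρ, hu, e.apply_symm_apply]⟩
  refine ⟨fun i x => e x ∈ Δ i, fun i => ⟨fun u hu x _ => ?_, fun u hu v hv hu3 hv3 x _ => ?_⟩,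
    fun i j u hu => hinj ?_⟩
  · obtain ⟨k, hk⟩ := (hΔ i).1 ⟨ρ u, hmem i u hu⟩
    refine ⟨k, (hρ1 _).1 ?_ x⟩
    rw [map_pow]
    exact congrArg Subtype.val hk
  · have h := (hΔ i).2 ⟨ρ u, hmem i u hu⟩ ⟨ρ v, hmem i v hv⟩
      (Subtype.ext (by
        change ρ u ^ 3 = 1
        rw [← map_pow, hρ1]
        exact fun x => hu3 x trivial))
      (Subtype.ext (by
        change ρ v ^ 3 = 1
        rw [← map_pow, hρ1]
        exact fun x => hv3 x trivial))
    have h' : ρ u * ρ v = ρ v * ρ u := congrArg Subtype.val h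
    rw [← map_mul, ← map_mul] at h'
    have := Equiv.congr_fun h' (e x)
    rw [hρ, hρ, e.symm_apply_apply, e.injective.eq_iff] at this
    rwa [smul_smul, smul_smul]
  · have : Δ j = ρ u ⁻¹' Δ i := by
      ext w
      have : (e (u • e.symm w) ∈ Δ i) = (e (e.symm w) ∈ Δ j) := hu (e.symm w)
      rw [e.apply_symm_apply] at this
      exact (iff_of_eq this).symm
    change (Δ i).ncard = (Δ j).ncard
    rw [this, Set.ncard_preimage_of_injective_subset_range (ρ u).injective
      (by simp [(ρ u).surjective.range_eq])]

end Local

section Assembly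

variable {G Ω S C : Type*} [Group G] [MulAction G Ω] [MulAction G S]

/-- Combining a colouring of the base with three inequivalent colourings of each fibre. -/
theorem exists_combined_colouring (π : Ω → S) (hπ : ∀ (g : G) x, π (g • x) = g • π x)
    (d : S → Fin 3 → Ω → C)
    (hd : ∀ R i j (u : G), u • R = R → (∀ x, π x = R → d R i (u • x) = d R j x) → i = j)
    (cS : S → Fin 3) :
    ∃ (c : Ω → C) (t : S → G), ∀ g : G, (∀ x, c (g • x) = c x) →
      (∀ B, cS (g • B) = cS B) ∧ ∀ B, g • B = B → ∀ x, π x = (t B)⁻¹ • B →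
        d ((t B)⁻¹ • B) (cS B) (((t B)⁻¹ * g * t B) • x) = d ((t B)⁻¹ • B) (cS B) x := by
  have hex : ∀ B : S, ∃ t : G, t • (Quotient.out (Quotient.mk (MulAction.orbitRel G S) B)) = B :=
    fun B => (MulAction.orbitRel G S).symm (Quotient.mk_out (s := MulAction.orbitRel G S) B)
  choose t ht using hex
  have hr : ∀ B, (t B)⁻¹ • B = Quotient.out (Quotient.mk (MulAction.orbitRel G S) B) := fun B => by
    rw [inv_smul_eq_iff, ht]
  have hrg : ∀ (g : G) B, (t (g • B))⁻¹ • g • B = (t B)⁻¹ • B := fun g B => by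
    rw [hr, hr]
    congr 1
    exact Quotient.sound (s := MulAction.orbitRel G S) ⟨g, rfl⟩
  let c : Ω → C := fun x => d ((t (π x))⁻¹ • π x) (cS (π x)) ((t (π x))⁻¹ • x)
  have hc : ∀ B x, π x = (t B)⁻¹ • B → c (t B • x) = d ((t B)⁻¹ • B) (cS B) x := fun B x hx => by
    have h : π (t B • x) = B := by rw [hπ, hx, smul_inv_smul]
    change d ((t (π (t B • x)))⁻¹ • π (t B • x)) _ _ = _
    rw [h, inv_smul_smul]
  have key : ∀ (g : G), (∀ x, c (g • x) = c x) → ∀ B x, π x = (t B)⁻¹ • B →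
      d ((t B)⁻¹ • B) (cS (g • B)) (((t (g • B))⁻¹ * g * t B) • x) =
        d ((t B)⁻¹ • B) (cS B) x := by
    intro g hg B x hx
    rw [← hc B x hx, ← hg, ← hrg g B, ← hc]
    · simp only [smul_smul, mul_assoc, mul_inv_cancel_left]
    · rw [hπ, hx, smul_smul, hrg, ← hrg g B, smul_smul]
      simp [mul_assoc]
  have hcS : ∀ g : G, (∀ x, c (g • x) = c x) → ∀ B, cS (g • B) = cS B := fun g hg B => by
    refine hd _ _ _ ((t (g • B))⁻¹ * g * t B) ?_ (key g hg B)
    rw [← smul_smul, smul_inv_smul, ← smul_smul, hrg]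
  refine ⟨c, t, fun g hg => ⟨hcS g hg, fun B hB x hx => ?_⟩⟩
  have := key g hg B x hx
  rwa [hB] at this

theorem conj_pow_smul {t g : G} {n : ℕ} {x : Ω} :
    (t⁻¹ * g * t) ^ n • t⁻¹ • x = t⁻¹ • x ↔ g ^ n • x = x := by
  have := conj_pow (a := t⁻¹) (b := g) (i := n)
  rw [inv_inv] at this
  rw [this, smul_smul, mul_inv_cancel_right, mul_smul, smul_left_cancel_iff]

theorem pow_smul_invariant {c : Ω → C} {g : G} (hg : ∀ x, c (g • x) = c x) (n : ℕ) (x : Ω) :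
    c (g ^ n • x) = c x := by
  induction n with
  | zero => simp
  | succ n ih => rw [pow_succ', mul_smul, hg, ih]

end Assembly

section Transfer

variable {G Ω S C : Type*} [Group G] [MulAction G Ω] [MulAction G S]

theorem exists_colouring_twoOn (π : Ω → S) (hπ : ∀ (g : G) x, π (g • x) = g • π x)
    (d : S → Fin 3 → Ω → C)
    (hd : ∀ R i j (u : G), u • R = R → (∀ x, π x = R → d R i (u • x) = d R j x) → i = j)
    (hd2 : ∀ R i, TwoOn {u : G | u • R = R ∧ ∀ x, π x = R → d R i (u • x) = d R i x} {x | π x = R})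
    (cS : S → Fin 3) (hcS : TwoOn {g : G | ∀ B, cS (g • B) = cS B} (Set.univ : Set S)) :
    ∃ c : Ω → C, TwoOn {g : G | ∀ x, c (g • x) = c x} (Set.univ : Set Ω) := by
  obtain ⟨c, t, hc⟩ := exists_combined_colouring π hπ d hd cS
  refine ⟨c, fun g hg x _ => ?_⟩
  obtain ⟨k, hk⟩ := hcS g (hc g hg).1 (π x) trivial
  obtain ⟨l, hl⟩ := hd2 _ _ ((t (π x))⁻¹ * g ^ 2 ^ k * t (π x))
    ⟨by rw [← smul_smul, smul_inv_smul, ← smul_smul, hk],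
      (hc _ fun y => pow_smul_invariant hg _ y).2 (π x) hk⟩ ((t (π x))⁻¹ • x) (hπ _ _)
  rw [conj_pow_smul, ← pow_mul, ← pow_add] at hl
  exact ⟨_, hl⟩

theorem exists_colouring_threeTwoOn (π : Ω → S) (hπ : ∀ (g : G) x, π (g • x) = g • π x)
    (d : S → Fin 3 → Ω → C)
    (hd : ∀ R i j (u : G), u • R = R → (∀ x, π x = R → d R i (u • x) = d R j x) → i = j)
    (hd2 : ∀ R i,
      ThreeTwoOn {u : G | u • R = R ∧ ∀ x, π x = R → d R i (u • x) = d R i x} {x | π x = R})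
    (cS : S → Fin 3) (hcS : TwoOn {g : G | ∀ B, cS (g • B) = cS B} (Set.univ : Set S)) :
    ∃ c : Ω → C, ThreeTwoOn {g : G | ∀ x, c (g • x) = c x} (Set.univ : Set Ω) := by
  obtain ⟨c, t, hc⟩ := exists_combined_colouring π hπ d hd cS
  have hmem : ∀ g : G, (∀ x, c (g • x) = c x) → ∀ B : S, g • B = B → (t B)⁻¹ * g * t B ∈
      {u : G | u • (t B)⁻¹ • B = (t B)⁻¹ • B ∧ ∀ x, π x = (t B)⁻¹ • B →
        d ((t B)⁻¹ • B) (cS B) (u • x) = d ((t B)⁻¹ • B) (cS B) x} := fun g hg B hB =>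
    ⟨by rw [← smul_smul, smul_inv_smul, ← smul_smul, hB], (hc g hg).2 B hB⟩
  refine ⟨c, fun g hg x _ => ?_, fun g hg h hh hg3 hh3 x _ => ?_⟩
  · obtain ⟨k, hk⟩ := hcS g (hc g hg).1 (π x) trivial
    obtain ⟨l, hl⟩ := (hd2 _ _).1 _ (hmem _ (fun y => pow_smul_invariant hg _ y) (π x) hk)
      ((t (π x))⁻¹ • x) (hπ _ _)
    rw [conj_pow_smul, ← pow_mul, mul_left_comm, ← pow_add] at hl
    exact ⟨_, hl⟩
  · have hfix : ∀ g : G, (∀ x, c (g • x) = c x) → (∀ x ∈ (Set.univ : Set Ω), g ^ 3 • x = x) →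
        g • π x = π x := fun g hg hg3 => by
      obtain ⟨k, hk⟩ := hcS g (hc g hg).1 (π x) trivial
      exact smul_eq_of_pow_two_pow_of_odd (m := 3) (by decide) hk (by rw [← hπ, hg3 x trivial])
    have hcube : ∀ g : G, (∀ x ∈ (Set.univ : Set Ω), g ^ 3 • x = x) →
        ∀ y ∈ {y | π y = (t (π x))⁻¹ • π x}, ((t (π x))⁻¹ * g * t (π x)) ^ 3 • y = y :=
      fun g hg3 y _ => by
        rw [← inv_smul_smul (t (π x)) y, conj_pow_smul, hg3 _ trivial]
    have := (hd2 _ _).2 _ (hmem g hg (π x) (hfix g hg hg3)) _ (hmem h hh (π x) (hfix h hh hh3))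
      (hcube g hg3) (hcube h hh3) ((t (π x))⁻¹ • x) (hπ _ _)
    simp only [smul_smul, mul_assoc, mul_inv_cancel_left, mul_inv_cancel, mul_one] at this
    rw [mul_smul _ (g * h), mul_smul _ (h * g), smul_left_cancel_iff] at this
    rw [smul_smul, smul_smul, this]

end Transfer

section Blocks

variable {G Ω : Type*} [Group G] [MulAction G Ω]

/-- The orbits of a subgroup. -/
def Blocks (N : Subgroup G) (Ω : Type*) [MulAction G Ω] := MulAction.orbitRel.Quotient N Ω

variable {N : Subgroup G}

/-- The orbit of a point. -/
def toBlock (N : Subgroup G) (x : Ω) : Blocks N Ω := Quotient.mk (MulAction.orbitRel N Ω) x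

theorem toBlock_eq {x y : Ω} : toBlock N x = toBlock N y ↔ ∃ k ∈ N, k • x = y := by
  rw [eq_comm]
  refine (Quotient.eq (r := MulAction.orbitRel N Ω)).trans ?_
  rw [MulAction.orbitRel_apply, MulAction.mem_orbit_iff]
  simp [Subgroup.smul_def]

theorem toBlock_surjective : Function.Surjective (toBlock N : Ω → Blocks N Ω) :=
  Quotient.mk_surjective

instance [Finite Ω] : Finite (Blocks N Ω) := Finite.of_surjective _ toBlock_surjective

instance [N.Normal] : MulAction G (Blocks N Ω) where
  smul g := Quotient.lift (fun x => toBlock N (g • x)) fun x y h => by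
    obtain ⟨k, hk, rfl⟩ := toBlock_eq.1 (Quotient.sound h : toBlock N x = toBlock N y)
    exact toBlock_eq.2 ⟨_, Subgroup.Normal.conj_mem inferInstance k hk g, by simp [smul_smul]⟩
  one_smul B := by
    obtain ⟨x, rfl⟩ := toBlock_surjective B
    exact congrArg _ (one_smul G x)
  mul_smul g h B := by
    obtain ⟨x, rfl⟩ := toBlock_surjective B
    exact congrArg _ (mul_smul g h x)

theorem toBlock_smul [N.Normal] (g : G) (x : Ω) : toBlock N (g • x) = g • toBlock N x := rfl

theorem card_blocks_lt [Finite Ω] (h : ∃ k ∈ N, ∃ x : Ω, k • x ≠ x) :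
    Nat.card (Blocks N Ω) < Nat.card Ω := by
  obtain ⟨k, hk, x, hx⟩ := h
  refine lt_of_le_of_ne (Nat.card_le_card_of_surjective _ toBlock_surjective) fun hc => hx ?_
  have := (Nat.bijective_iff_surjective_and_card _).2
    ⟨toBlock_surjective (N := N) (Ω := Ω), hc.symm⟩
  exact (this.1 (toBlock_eq.2 ⟨k, hk, rfl⟩)).symm

/-- The action on a block of its stabilizer. -/
abbrev blockAction [N.Normal] (R : Blocks N Ω) :
    MulAction (MulAction.stabilizer G R) {x : Ω // toBlock N x = R} where
  smul u x := ⟨u • x.1, by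
    change toBlock N ((u : G) • x.1) = R
    rw [toBlock_smul, x.2]; exact u.2⟩
  one_smul x := Subtype.ext (one_smul G x.1)
  mul_smul u v x := Subtype.ext (mul_smul (u : G) (v : G) x.1)

theorem mem_stabilizer_block [N.Normal] (R : Blocks N Ω) {k : G} (hk : k ∈ N) :
    k ∈ MulAction.stabilizer G R := by
  obtain ⟨x, rfl⟩ := toBlock_surjective R
  exact (toBlock_eq.2 ⟨k, hk, rfl⟩).symm

theorem exists_fibre_colourings_two [N.Normal] [Finite Ω] {p : ℕ} (hp : p.Prime)
    (hN : ActsElementary p N Ω) (R : Blocks N Ω) :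
    ∃ d : Fin 3 → Ω → Fin 3,
      (∀ i j (u : G), u • R = R → (∀ x, toBlock N x = R → d i (u • x) = d j x) → i = j) ∧
      ∀ i, TwoOn {u : G | u • R = R ∧ ∀ x, toBlock N x = R → d i (u • x) = d i x}
        {x | toBlock N x = R} := by
  classical
  let _ := blockAction R
  obtain ⟨x₀, hx₀⟩ := toBlock_surjective R
  have hK : ActsElementary p (N.subgroupOf (MulAction.stabilizer G R))
      {x : Ω // toBlock N x = R} :=
    ⟨fun a ha b hb x => Subtype.ext (hN.comm a ha b hb x),
      fun a ha x => Subtype.ext (hN.pow a ha x)⟩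
  obtain ⟨d, h1, h2⟩ := hK.exists_three_colourings hp ⟨x₀, hx₀⟩ fun x y => by
    obtain ⟨k, hk, hkx⟩ := toBlock_eq.1 (x.2.trans y.2.symm)
    exact ⟨⟨k, mem_stabilizer_block R hk⟩, hk, Subtype.ext hkx⟩
  let d' : Fin 3 → Ω → Fin 3 := fun i x => if h : toBlock N x = R then d i ⟨x, h⟩ else 0
  have hd' : ∀ i x, d' i x.1 = d i x := fun i x => dif_pos x.2
  refine ⟨d', fun i j u hu h => ?_, fun i u hu x hx => ?_⟩
  · refine h2 i j ⟨u, hu⟩ fun x => ?_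
    rw [← hd', ← hd']
    exact h x x.2
  · obtain ⟨k, hk⟩ := h1 i ⟨u, hu.1⟩ (fun x => by
      rw [← hd', ← hd']
      exact hu.2 x x.2) ⟨x, hx⟩ trivial
    exact ⟨k, congrArg Subtype.val hk⟩

theorem exists_fibre_colourings_threeTwo [N.Normal] [Finite Ω] [Group.IsSolvable G] {p : ℕ}
    (hp : p.Prime) (hN : ActsElementary p N Ω) (R : Blocks N Ω)
    (hmove : ∃ k ∈ N, ∃ x, toBlock N x = R ∧ k • x ≠ x) :
    ∃ d : Fin 3 → Ω → Prop,
      (∀ i j (u : G), u • R = R → (∀ x, toBlock N x = R → d i (u • x) = d j x) → i = j) ∧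
      ∀ i, ThreeTwoOn {u : G | u • R = R ∧ ∀ x, toBlock N x = R → d i (u • x) = d i x}
        {x | toBlock N x = R} := by
  classical
  let _ := blockAction R
  obtain ⟨k₀, hk₀, x₀, hx₀, hne⟩ := hmove
  have hK : ActsElementary p (N.subgroupOf (MulAction.stabilizer G R))
      {x : Ω // toBlock N x = R} :=
    ⟨fun a ha b hb x => Subtype.ext (hN.comm a ha b hb x),
      fun a ha x => Subtype.ext (hN.pow a ha x)⟩
  have : Nontrivial {x : Ω // toBlock N x = R} :=
    ⟨⟨k₀ • x₀, (toBlock_eq.2 ⟨k₀, hk₀, rfl⟩).symm.trans hx₀⟩, ⟨x₀, hx₀⟩,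
      fun h => hne (congrArg Subtype.val h)⟩
  obtain ⟨d, h1, h2⟩ := hK.exists_three_sets hp ⟨x₀, hx₀⟩ fun x y => by
    obtain ⟨k, hk, hkx⟩ := toBlock_eq.1 (x.2.trans y.2.symm)
    exact ⟨⟨k, mem_stabilizer_block R hk⟩, hk, Subtype.ext hkx⟩
  let d' : Fin 3 → Ω → Prop := fun i x => ∃ h : toBlock N x = R, d i ⟨x, h⟩
  have hd' : ∀ i x, d' i x.1 = d i x := fun i x => propext ⟨fun h => h.2, fun h => ⟨x.2, h⟩⟩
  have hU : ∀ i, ∀ u ∈ {u : G | u • R = R ∧ ∀ x, toBlock N x = R → d' i (u • x) = d' i x},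
      ∃ hu : u • R = R, (⟨u, hu⟩ : MulAction.stabilizer G R) ∈
        {u : MulAction.stabilizer G R | ∀ x, d i (u • x) = d i x} := fun i u hu =>
    ⟨hu.1, fun x => by
      rw [← hd', ← hd']
      exact hu.2 x x.2⟩
  refine ⟨d', fun i j u hu h => ?_, fun i => ⟨fun u hu x hx => ?_,
    fun u hu v hv hu3 hv3 x hx => ?_⟩⟩
  · refine h2 i j ⟨u, hu⟩ fun x => ?_
    rw [← hd', ← hd']
    exact h x x.2
  · obtain ⟨_, hu'⟩ := hU i u hu
    obtain ⟨k, hk⟩ := (h1 i).1 _ hu' ⟨x, hx⟩ trivial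
    exact ⟨k, congrArg Subtype.val hk⟩
  · obtain ⟨_, hu'⟩ := hU i u hu
    obtain ⟨_, hv'⟩ := hU i v hv
    exact congrArg Subtype.val ((h1 i).2 _ hu' _ hv' (fun y _ => Subtype.ext (hu3 y y.2))
      (fun y _ => Subtype.ext (hv3 y y.2)) ⟨x, hx⟩ trivial)

end Blocks

/-- A nontrivial finite solvable group has a nontrivial normal elementary abelian subgroup. -/
theorem exists_normal_elementary (R : Type*) [Group R] [Finite R] [Group.IsSolvable R]
    [Nontrivial R] : ∃ (p : ℕ) (V : Subgroup R), p.Prime ∧ V.Normal ∧ V ≠ ⊥ ∧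
      (∀ a ∈ V, ∀ b ∈ V, a * b = b * a) ∧ ∀ a ∈ V, a ^ p = 1 := by
  classical
  have hex : ∃ n, derivedSeries R n = ⊥ := Group.IsSolvable.solvable
  obtain ⟨n, hn⟩ : ∃ n, Nat.find hex = n + 1 := Nat.exists_eq_succ_of_ne_zero fun h0 => by
    have := Nat.find_spec hex
    rw [h0, derivedSeries_zero] at this
    exact top_ne_bot this
  have hne : derivedSeries R n ≠ ⊥ := Nat.find_min hex (by omega)
  have hcomm : ∀ a ∈ derivedSeries R n, ∀ b ∈ derivedSeries R n, a * b = b * a := by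
    intro a ha b hb
    have hbot := Nat.find_spec hex
    rw [hn, derivedSeries_succ] at hbot
    have := Subgroup.commutator_mem_commutator ha hb
    rw [hbot, Subgroup.mem_bot] at this
    exact commutatorElement_eq_one_iff_mul_comm.1 this
  have hnorm : (derivedSeries R n).Normal := derivedSeries_normal R n
  have hcard : Nat.card (derivedSeries R n) ≠ 1 := fun h => hne (Subgroup.card_eq_one.1 h)
  obtain ⟨p, hp, hdvd⟩ := Nat.exists_prime_and_dvd hcard
  have := Fact.mk hp
  obtain ⟨x, hx⟩ := exists_prime_orderOf_dvd_card' p hdvd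
  let V : Subgroup R :=
    { carrier := {a | a ∈ derivedSeries R n ∧ a ^ p = 1}
      one_mem' := ⟨one_mem _, one_pow _⟩
      mul_mem' := fun {a b} ha hb => ⟨mul_mem ha.1 hb.1, by
        rw [Commute.mul_pow (hcomm a ha.1 b hb.1), ha.2, hb.2, one_mul]⟩
      inv_mem' := fun {a} ha => ⟨inv_mem ha.1, by rw [inv_pow, ha.2, inv_one]⟩ }
  refine ⟨p, V, hp, ⟨fun a ha g => ⟨hnorm.conj_mem a ha.1 g, by
    rw [conj_pow, ha.2, mul_one, mul_inv_cancel]⟩⟩, fun hV => ?_,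
    fun a ha b hb => hcomm a ha.1 b hb.1, fun a ha => ha.2⟩
  have hxV : (x : R) ∈ V := ⟨x.2, by
    rw [← hx]
    exact congrArg Subtype.val (pow_orderOf_eq_one x)⟩
  rw [hV, Subgroup.mem_bot] at hxV
  have h1 : x = 1 := Subtype.ext hxV
  rw [h1, orderOf_one] at hx
  exact hp.one_lt.ne hx

theorem exists_actsElementary {G Ω : Type*} [Group G] [MulAction G Ω] [Finite Ω]
    [Group.IsSolvable G] (h : ∃ (g : G) (x : Ω), g • x ≠ x) :
    ∃ (p : ℕ) (N : Subgroup G), p.Prime ∧ N.Normal ∧ ActsElementary p N Ω ∧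
      ∃ k ∈ N, ∃ x : Ω, k • x ≠ x := by
  let f := (MulAction.toPermHom G Ω).rangeRestrict
  have hf : Function.Surjective f := MonoidHom.rangeRestrict_surjective _
  have : Group.IsSolvable (MulAction.toPermHom G Ω).range := Group.isSolvable_of_surjective hf
  obtain ⟨g, x, hgx⟩ := h
  have : Nontrivial (MulAction.toPermHom G Ω).range :=
    ⟨f g, 1, fun h => hgx (Equiv.congr_fun (congrArg Subtype.val h) x)⟩
  obtain ⟨p, V, hp, hV, hne, hcomm, hpow⟩ :=
    exists_normal_elementary (MulAction.toPermHom G Ω).range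
  refine ⟨p, V.comap f, hp, inferInstance, ⟨fun a ha b hb x => ?_, fun a ha x => ?_⟩, ?_⟩
  · exact Equiv.congr_fun (congrArg Subtype.val (hcomm _ ha _ hb)) x
  · have := hpow _ ha
    rw [← map_pow] at this
    exact Equiv.congr_fun (congrArg Subtype.val this) x
  · by_contra! hc
    refine hne ((Subgroup.eq_bot_iff_forall _).2 fun v hv => ?_)
    obtain ⟨k, rfl⟩ := hf v
    exact Subtype.ext (Equiv.ext (hc k hv))

/-- A solvable permutation group has a colouring with three colours whose stabilizer is a
2-group. -/
theorem exists_three_colouring {G : Type*} [Group G] [Group.IsSolvable G] (Ω : Type*)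
    [MulAction G Ω] [Finite Ω] :
    ∃ c : Ω → Fin 3, TwoOn {g : G | ∀ x, c (g • x) = c x} (Set.univ : Set Ω) := by
  induction hn : Nat.card Ω using Nat.strong_induction_on generalizing Ω with
  | _ n ih =>
    by_cases h : ∃ (g : G) (x : Ω), g • x ≠ x
    · obtain ⟨p, N, hp, _, hN, hmove⟩ := exists_actsElementary h
      obtain ⟨cS, hcS⟩ := ih _ (hn ▸ card_blocks_lt hmove) (Blocks N Ω) rfl
      choose d hd hd2 using exists_fibre_colourings_two hp hN
      exact exists_colouring_twoOn (toBlock N) toBlock_smul d hd hd2 cS hcS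
    · push Not at h
      exact ⟨fun _ => 0, fun g _ x _ => ⟨0, h _ _⟩⟩

theorem exists_set_of_isPretransitive {G Ω : Type*} [Group G] [Group.IsSolvable G]
    [MulAction G Ω] [Finite Ω] [MulAction.IsPretransitive G Ω] :
    ∃ c : Ω → Prop, ThreeTwoOn {g : G | ∀ x, c (g • x) = c x} (Set.univ : Set Ω) := by
  by_cases h : ∃ (g : G) (x : Ω), g • x ≠ x
  · obtain ⟨p, N, hp, _, hN, k, hk, x, hkx⟩ := exists_actsElementary h
    obtain ⟨cS, hcS⟩ := exists_three_colouring (G := G) (Blocks N Ω)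
    choose d hd hd2 using fun R : Blocks N Ω => exists_fibre_colourings_threeTwo hp hN R (by
      obtain ⟨y, rfl⟩ := toBlock_surjective R
      obtain ⟨g, rfl⟩ := MulAction.exists_smul_eq G x y
      refine ⟨_, Subgroup.Normal.conj_mem inferInstance k hk g, g • x, rfl, ?_⟩
      rwa [smul_smul, inv_mul_cancel_right, mul_smul, Ne, smul_left_cancel_iff])
    exact exists_colouring_threeTwoOn (toBlock N) toBlock_smul d hd hd2 cS hcS
  · push Not at h
    exact ⟨fun _ => True, fun g _ x _ => ⟨0, h _ _⟩, fun g _ k _ _ _ x _ => by simp only [h]⟩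

theorem exists_set {G Ω : Type*} [Group G] [Group.IsSolvable G] [MulAction G Ω] [Finite Ω] :
    ∃ c : Ω → Prop, ThreeTwoOn {g : G | ∀ x, c (g • x) = c x} (Set.univ : Set Ω) := by
  choose c hc using fun x : Ω =>
    exists_set_of_isPretransitive (G := G) (Ω := MulAction.orbit G x)
  let r : Ω → Ω := fun x => Quotient.out (Quotient.mk (MulAction.orbitRel G Ω) x)
  have hr : ∀ x, x ∈ MulAction.orbit G (r x) := fun x =>
    (MulAction.orbitRel G Ω).symm (Quotient.mk_out (s := MulAction.orbitRel G Ω) x)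
  have hrg : ∀ x, ∀ y : MulAction.orbit G (r x), r y = r x := fun x y => by
    have : Quotient.mk (MulAction.orbitRel G Ω) y.1 = Quotient.mk (MulAction.orbitRel G Ω) x := by
      rw [← Quotient.out_eq (Quotient.mk (MulAction.orbitRel G Ω) x)]
      exact Quotient.sound y.2
    exact congrArg Quotient.out this
  let c' : Ω → Prop := fun x => c (r x) ⟨x, hr x⟩
  have hc' : ∀ x (y : MulAction.orbit G (r x)), c' y = c (r x) y := fun x y => by
    have : ∀ z, z = r x → ∀ h : y.1 ∈ MulAction.orbit G z, c z ⟨y.1, h⟩ = c (r x) y := by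
      rintro _ rfl _
      rfl
    exact this _ (hrg x y) _
  have hU : ∀ x, ∀ g ∈ {g : G | ∀ x, c' (g • x) = c' x},
      g ∈ {g : G | ∀ y, c (r x) (g • y) = c (r x) y} := fun x g hg y => by
    rw [← hc', ← hc']
    exact hg y
  refine ⟨c', fun g hg x _ => ?_, fun g hg h hh hg3 hh3 x _ => ?_⟩
  · obtain ⟨k, hk⟩ := (hc (r x)).1 g (hU x g hg) ⟨x, hr x⟩ trivial
    exact ⟨k, congrArg Subtype.val hk⟩
  · exact congrArg Subtype.val ((hc (r x)).2 g (hU x g hg) h (hU x h hh)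
      (fun y _ => Subtype.ext (hg3 y trivial)) (fun y _ => Subtype.ext (hh3 y trivial))
      ⟨x, hr x⟩ trivial)

theorem ThreeTwoOn.isThreeTwo {Ω : Type*} [Finite Ω] {G : Subgroup (Perm Ω)} {U : Set G}
    (h : ThreeTwoOn U (Set.univ : Set Ω)) (S : Subgroup G) (hS : ∀ g ∈ S, g ∈ U) :
    IsThreeTwo S := by
  have hcube : ∀ g : S, g ^ 3 = 1 → ∀ x ∈ (Set.univ : Set Ω), (g : G) ^ 3 • x = x :=
    fun g hg x _ => by
      have : (g : G) ^ 3 = 1 := congrArg Subtype.val hg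
      rw [this, one_smul]
  refine ⟨fun g => ?_, fun g k hg hk => ?_⟩
  · choose k hk using fun x => h.1 g (hS g g.2) x trivial
    obtain ⟨K, hK⟩ := (Set.finite_range k).bddAbove
    refine ⟨K, Subtype.ext (Subtype.ext (Equiv.ext fun x => ?_))⟩
    change (g : G) ^ (3 * 2 ^ K) • x = x
    rw [MulAction.pow_smul_eq_iff_period_dvd]
    exact (MulAction.pow_smul_eq_iff_period_dvd.1 (hk x)).trans
      (mul_dvd_mul_left 3 (pow_dvd_pow 2 (hK ⟨x, rfl⟩)))
  · exact Subtype.ext (Subtype.ext (Equiv.ext fun x =>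
      h.2 g (hS g g.2) k (hS k k.2) (hcube g hg) (hcube k hk) x trivial))

end SetStabilizer

/-- Corollary 3.3: every finite solvable permutation group has a set-stabilizer `S`
such that `O²(S)` is a (possibly trivial) elementary abelian 3-group. -/
theorem stmt_0 {Ω : Type*} [Fintype Ω] (G : Subgroup (Equiv.Perm Ω))
    (hsolv : IsSolvable G) :
    ∃ Δ : Set Ω, RequiredStructure (MulAction.stabilizer G Δ) := by
  have : Group.IsSolvable G := hsolv
  obtain ⟨c, hc⟩ := SetStabilizer.exists_set (G := G) (Ω := Ω)
  refine ⟨{x | c x}, (hc.isThreeTwo _ fun g hg x => propext ?_).requiredStructure⟩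
  rw [MulAction.mem_stabilizer_iff] at hg
  have := Set.smul_mem_smul_set_iff (a := g) (s := {x | c x}) (x := x)
  rwa [hg] at this
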